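/- For any dimension d ≥ 1, any weight vector w ∈ (0,1)^d, and any τ > 1, dim_H W_w(τ) = min_{1≤k≤d} (d + 1 + Σ_{i=1}^k (τ w_k − τ w_i)) / (1 + τ w_k). -/

import Mathlib

open Real MeasureTheory Set

/-- The weighted norm `‖x‖_u = max_i |x_i|^(1/u_i)`. -/
noncomputable def wNorm {d : ℕ} (u : Fin d → ℝ) (x : Fin d → ℝ) : ℝ :=
  ⨆ i, |x i| ^ (1 / u i)

/-- The set `W_w(c,τ)` of `w`-weighted `(c,τ)`-approximable vectors in `[0,1)^d`. -/
noncomputable def wApprox {d : ℕ} (w : Fin d → ℝ) (c τ : ℝ) : Set (Fin d → ℝ) :=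
  {x | (∀ i, x i ∈ Set.Ico (0 : ℝ) 1) ∧
    {pq : (Fin d → ℤ) × ℕ | 0 < pq.2 ∧
      wNorm w (fun i => (pq.2 : ℝ) * x i - (pq.1 i : ℝ)) < c * (pq.2 : ℝ) ^ (-τ)}.Infinite}

namespace WA

/-- pair count -/
lemma pair_count (q q' : ℕ) (hq : 0 < q) (hq' : 0 < q') (l : ℝ) (hl : 0 ≤ l) :
    ((((Finset.range q) ×ˢ (Finset.range q')).filter
      (fun x : ℕ × ℕ => |(x.1 : ℝ) / q - (x.2 : ℝ) / q'| ≤ l)).card : ℝ)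
      ≤ (Nat.gcd q q' : ℝ) + 2 * l * q * q' := by
  set g := Nat.gcd q q' with hg
  have hgpos : 0 < g := Nat.gcd_pos_of_pos_left _ hq
  obtain ⟨u, hu⟩ : g ∣ q := Nat.gcd_dvd_left _ _
  obtain ⟨v, hv⟩ : g ∣ q' := Nat.gcd_dvd_right _ _
  have hu0 : 0 < u := Nat.pos_of_ne_zero (by rintro rfl; simp at hu; omega)
  have hv0 : 0 < v := Nat.pos_of_ne_zero (by rintro rfl; simp at hv; omega)
  have hcop : Nat.Coprime u v := by
    have h1 : g = g * Nat.gcd u v := by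
      conv_lhs => rw [hg, hu, hv, Nat.gcd_mul_left]
    have : Nat.gcd u v = 1 := by
      have := Nat.eq_of_mul_eq_mul_left hgpos (h1.symm.trans (mul_one g).symm)
      exact this
    exact this
  have hqr : (q : ℝ) = g * u := by exact_mod_cast hu
  have hqr' : (q' : ℝ) = g * v := by exact_mod_cast hv
  have hgr : (0 : ℝ) < g := by exact_mod_cast hgpos
  have hur : (0 : ℝ) < u := by exact_mod_cast hu0
  have hvr : (0 : ℝ) < v := by exact_mod_cast hv0
  set B : ℤ := ⌊l * g * u * v⌋ with hB
  have hB0 : 0 ≤ B := Int.floor_nonneg.2 (by positivity)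
  set S := ((Finset.range q) ×ˢ (Finset.range q')).filter
      (fun x : ℕ × ℕ => |(x.1 : ℝ) / q - (x.2 : ℝ) / q'| ≤ l) with hS
  have key : S.card ≤ ((Finset.Icc (-B) B) ×ˢ (Finset.range g)).card := by
    apply Finset.card_le_card_of_injOn
      (fun x : ℕ × ℕ => (((x.1 : ℤ) * v - (x.2 : ℤ) * u), x.1 / u))
    · intro x hx
      simp only [hS, Finset.coe_filter, Finset.mem_product, Finset.mem_range, Set.mem_ofPred_eq] at hx
      obtain ⟨⟨h1, h2⟩, h3⟩ := hx
      have hle : |((x.1 : ℝ) * v - (x.2 : ℝ) * u)| ≤ l * g * u * v := by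
        have : ((x.1 : ℝ) * v - (x.2 : ℝ) * u) = ((x.1 : ℝ) / q - (x.2 : ℝ) / q') * (g * u * v) := by
          rw [hqr, hqr']; field_simp
        rw [this, abs_mul, abs_of_pos (by positivity : (0:ℝ) < g * u * v)]
        calc _ ≤ l * (g * u * v) := by gcongr
          _ = _ := by ring
      rw [abs_le] at hle
      simp only [Finset.coe_product, Set.mem_prod, Finset.coe_Icc, Set.mem_Icc, Finset.coe_range, Set.mem_Iio]
      refine ⟨⟨?_, ?_⟩, ?_⟩
      · rw [neg_le, hB, Int.le_floor]; push_cast; linarith [hle.1]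
      · rw [hB, Int.le_floor]; push_cast; linarith [hle.2]
      · rw [Nat.div_lt_iff_lt_mul hu0, ← hu]; exact h1
    · intro x hx y hy hxy
      simp only [Prod.mk.injEq] at hxy
      obtain ⟨e1, e2⟩ := hxy
      have e3 : ((x.1 : ℤ) - y.1) * v = ((x.2 : ℤ) - y.2) * u := by linarith
      have hdvd : (u : ℤ) ∣ (x.1 : ℤ) - y.1 := by
        have : IsCoprime (u : ℤ) (v : ℤ) := Nat.isCoprime_iff_coprime.2 hcop
        exact this.dvd_of_dvd_mul_right ⟨(x.2 : ℤ) - y.2, by rw [e3]; ring⟩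
      have hmod : y.1 ≡ x.1 [MOD u] := (Nat.modEq_iff_dvd).2 hdvd
      have e4 : x.1 = y.1 := by
        rw [← Nat.div_add_mod x.1 u, ← Nat.div_add_mod y.1 u, e2, hmod]
      have e5 : x.2 = y.2 := by
        rw [e4] at e3
        simp at e3
        rcases e3 with h | h
        · omega
        · omega
      exact Prod.ext e4 e5
  have h2 : ((Finset.Icc (-B) B) ×ˢ (Finset.range g)).card = (2 * B + 1).toNat * g := by
    rw [Finset.card_product, Int.card_Icc, Finset.card_range]; congr 2; ring
  rw [h2] at key
  have key2 : (S.card : ℝ) ≤ (2 * B + 1 : ℝ) * g := by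
    have : (S.card : ℤ) ≤ (2 * B + 1) * g := by
      have h3 : ((2 * B + 1).toNat : ℤ) = 2 * B + 1 := Int.toNat_of_nonneg (by omega)
      have : (S.card : ℤ) ≤ ((2 * B + 1).toNat * g : ℕ) := by exact_mod_cast key
      rw [Nat.cast_mul, h3] at this
      exact this
    exact_mod_cast this
  have hBle : (B : ℝ) ≤ l * g * u * v := Int.floor_le _
  calc (S.card : ℝ) ≤ (2 * B + 1 : ℝ) * g := key2
    _ ≤ (2 * (l * g * u * v) + 1) * g := by gcongr
    _ = _ := by rw [hqr, hqr']; ring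

/-- length of intersection of two half-open intervals -/
noncomputable def ov (a b P ρ : ℝ) : ℝ := volume.real (Ico a b ∩ Ico P (P + ρ))

lemma ov_nonneg (a b P ρ : ℝ) : 0 ≤ ov a b P ρ := measureReal_nonneg

lemma ov_eq (a b P ρ : ℝ) : ov a b P ρ = max (min b (P + ρ) - max a P) 0 := by
  unfold ov
  rw [Ico_inter_Ico, Real.volume_real_Ico]

lemma ov_le_left {a b P ρ : ℝ} (hab : a ≤ b) : ov a b P ρ ≤ b - a := by
  rw [ov_eq]
  refine max_le ?_ (by linarith)
  linarith [min_le_left b (P + ρ), le_max_left a P]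

lemma ov_le_right {a b P ρ : ℝ} (hρ : 0 ≤ ρ) : ov a b P ρ ≤ ρ := by
  rw [ov_eq]
  refine max_le ?_ hρ
  linarith [min_le_right b (P + ρ), le_max_right a P]

lemma ov_pos {a b P ρ : ℝ} (h : ov a b P ρ ≠ 0) : a < P + ρ ∧ P < b := by
  rw [ov_eq] at h
  have : 0 < min b (P + ρ) - max a P := by
    by_contra hh
    exact h (max_eq_right (not_lt.1 hh))
  have h1 := min_le_left b (P + ρ)
  have h2 := min_le_right b (P + ρ)
  have h3 := le_max_left a P
  have h4 := le_max_right a P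
  constructor <;> linarith

lemma ov_fin (a b P ρ : ℝ) : volume (Ico a b ∩ Ico P (P + ρ)) ≠ ⊤ :=
  ne_of_lt (lt_of_le_of_lt (measure_mono inter_subset_left) (by simp))

lemma ov_split {a b c : ℝ} (hab : a ≤ b) (hbc : b ≤ c) (P ρ : ℝ) :
    ov a c P ρ = ov a b P ρ + ov b c P ρ := by
  have e : Ico a c ∩ Ico P (P + ρ) = (Ico a b ∩ Ico P (P + ρ)) ∪ (Ico b c ∩ Ico P (P + ρ)) := by
    rw [← Set.union_inter_distrib_right, Ico_union_Ico_eq_Ico hab hbc]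
  unfold ov
  rw [e, measureReal_union (h₁ := ov_fin _ _ _ _) (h₂ := ov_fin _ _ _ _)]
  · exact Disjoint.mono inter_subset_left inter_subset_left
      (Ico_disjoint_Ico_same)
  · exact measurableSet_Ico.inter measurableSet_Ico

lemma sum_ov_le (n : ℕ) (r : ℝ) (hr : 0 ≤ r) (P ρ : ℝ) (hρ : 0 ≤ ρ) :
    ∑ k ∈ Finset.range n, ov (k * r) ((k + 1) * r) P ρ ≤ ρ := by
  have : ∑ k ∈ Finset.range n, ov (k * r) ((k + 1) * r) P ρ ≤ ov 0 (n * r) P ρ := by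
    induction n with
    | zero => simp [ov]
    | succ n ih =>
      rw [Finset.sum_range_succ]
      have hn : (0:ℝ) ≤ n * r := by positivity
      have h2 : ov 0 (n * r) P ρ + ov (n * r) ((n + 1) * r) P ρ ≤ ov 0 ((n + 1 : ℕ) * r) P ρ := by
        rw [ov_split hn (by push_cast; nlinarith : (n:ℝ) * r ≤ (n + 1 : ℕ) * r)]
        push_cast; rfl
      linarith
  exact this.trans (ov_le_right hρ)

/-- mass of an interval -/
noncomputable def mm (q : ℕ) (ρ a b : ℝ) : ℝ :=
  ∑ p ∈ Finset.range q, (1 / (q * ρ)) * ov a b ((p : ℝ) / q) ρ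

lemma mm_nonneg (q : ℕ) (ρ a b : ℝ) (hρ : 0 ≤ ρ) : 0 ≤ mm q ρ a b :=
  Finset.sum_nonneg fun p _ => mul_nonneg (by positivity) (ov_nonneg _ _ _ _)

lemma one_dim_energy (q q' : ℕ) (hq : 0 < q) (hq' : 0 < q') (n : ℕ) (r ρ : ℝ) (hr : 0 < r)
    (hρ : 0 < ρ) :
    ∑ k ∈ Finset.range n, mm q ρ (k * r) ((k + 1) * r) * mm q' ρ (k * r) ((k + 1) * r)
      ≤ min 1 (r / ρ) * ((Nat.gcd q q' : ℝ) / (q * q') + 2 * (r + ρ)) := by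
  have hqr : (0:ℝ) < q := by exact_mod_cast hq
  have hqr' : (0:ℝ) < q' := by exact_mod_cast hq'
  have e1 : ∀ k : ℕ, mm q ρ (k * r) ((k + 1) * r) * mm q' ρ (k * r) ((k + 1) * r)
      = ∑ x ∈ Finset.range q ×ˢ Finset.range q', (1 / (q * q')) *
        ((ov (k * r) ((k + 1) * r) ((x.1 : ℝ) / q) ρ / ρ) *
          (ov (k * r) ((k + 1) * r) ((x.2 : ℝ) / q') ρ / ρ)) := by
    intro k
    unfold mm
    rw [Finset.sum_mul_sum, Finset.sum_product]
    refine Finset.sum_congr rfl fun i _ => Finset.sum_congr rfl fun j _ => ?_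
    field_simp
  have e2 : ∀ x ∈ Finset.range q ×ˢ Finset.range q', ∑ k ∈ Finset.range n, (1 / ((q:ℝ) * q')) *
        ((ov (k * r) ((k + 1) * r) ((x.1 : ℝ) / q) ρ / ρ) *
          (ov (k * r) ((k + 1) * r) ((x.2 : ℝ) / q') ρ / ρ)) ≤
      if |(x.1 : ℝ) / q - (x.2 : ℝ) / q'| ≤ r + ρ then (1 / ((q:ℝ) * q')) * min 1 (r / ρ) else 0 := by
    intro x _
    split_ifs with hx
    · rw [← Finset.mul_sum]
      gcongr
      calc _ ≤ ∑ k ∈ Finset.range n, (ov (k * r) ((k + 1) * r) ((x.1 : ℝ) / q) ρ / ρ) * min 1 (r / ρ) := by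
            refine Finset.sum_le_sum fun k _ => ?_
            refine mul_le_mul_of_nonneg_left ?_ (div_nonneg (ov_nonneg _ _ _ _) hρ.le)
            refine le_min ?_ ?_
            · rw [div_le_one hρ]; exact ov_le_right hρ.le
            · gcongr
              refine (ov_le_left (by nlinarith)).trans (by linarith)
        _ = ((∑ k ∈ Finset.range n, ov (k * r) ((k + 1) * r) ((x.1 : ℝ) / q) ρ) / ρ) * min 1 (r / ρ) := by
            rw [← Finset.sum_mul, Finset.sum_div]
        _ ≤ 1 * min 1 (r / ρ) := by
            refine mul_le_mul_of_nonneg_right ?_ (le_min zero_le_one (by positivity))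
            rw [div_le_one hρ]; exact sum_ov_le n r hr.le _ ρ hρ.le
        _ = _ := one_mul _
    · refine (Finset.sum_eq_zero fun k _ => ?_).le
      by_contra hne
      have h1 : ov (k * r) ((k + 1) * r) ((x.1 : ℝ) / q) ρ ≠ 0 := by
        intro h; apply hne; simp [h]
      have h2 : ov (k * r) ((k + 1) * r) ((x.2 : ℝ) / q') ρ ≠ 0 := by
        intro h; apply hne; simp [h]
      obtain ⟨a1, a2⟩ := ov_pos h1
      obtain ⟨b1, b2⟩ := ov_pos h2
      apply hx
      rw [abs_le]
      constructor <;> nlinarith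
  calc _ = ∑ x ∈ Finset.range q ×ˢ Finset.range q', ∑ k ∈ Finset.range n, (1 / ((q:ℝ) * q')) *
        ((ov (k * r) ((k + 1) * r) ((x.1 : ℝ) / q) ρ / ρ) *
          (ov (k * r) ((k + 1) * r) ((x.2 : ℝ) / q') ρ / ρ)) := by
        rw [Finset.sum_comm]
        exact Finset.sum_congr rfl fun k _ => e1 k
    _ ≤ _ := Finset.sum_le_sum e2
    _ = ((((Finset.range q) ×ˢ (Finset.range q')).filter
      (fun x : ℕ × ℕ => |(x.1 : ℝ) / q - (x.2 : ℝ) / q'| ≤ r + ρ)).card : ℝ) *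
        ((1 / ((q:ℝ) * q')) * min 1 (r / ρ)) := by
        rw [← Finset.sum_filter, Finset.sum_const, nsmul_eq_mul]
    _ ≤ ((Nat.gcd q q' : ℝ) + 2 * (r + ρ) * q * q') * ((1 / ((q:ℝ) * q')) * min 1 (r / ρ)) := by
        refine mul_le_mul_of_nonneg_right (pair_count q q' hq hq' _ (by positivity)) ?_
        exact mul_nonneg (by positivity) (le_min zero_le_one (by positivity))
    _ = _ := by field_simp

lemma mm_zero_bounds (q : ℕ) (hq : 0 < q) (ρ : ℝ) (hρ : 0 < ρ) (hρq : ρ ≤ 1 / q) (x : ℝ)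
    (hx0 : 0 ≤ x) (hx1 : x ≤ 1) : |mm q ρ 0 x - x| ≤ 1 / q := by
  have hqr : (0:ℝ) < q := by exact_mod_cast hq
  set P := ⌊q * x⌋₊ with hP
  have hP1 : (P : ℝ) ≤ q * x := Nat.floor_le (by positivity)
  have hP2 : (q * x : ℝ) < P + 1 := Nat.lt_floor_add_one _
  have hPq : P ≤ q := by
    have : (P : ℝ) ≤ q := by nlinarith
    exact_mod_cast this
  have term_full : ∀ p : ℕ, p < P → (1 / (q * ρ)) * ov 0 x ((p : ℝ) / q) ρ = 1 / q := by
    intro p hp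
    have hp1 : (p : ℝ) + 1 ≤ P := by exact_mod_cast hp
    have h1 : (p : ℝ) / q + ρ ≤ x := by
      calc (p : ℝ) / q + ρ ≤ p / q + 1 / q := by gcongr
        _ = (p + 1) / q := by ring
        _ ≤ x := by rw [div_le_iff₀ hqr]; linarith
    have h0 : (0:ℝ) ≤ p / q := by positivity
    rw [ov_eq, min_eq_right h1, max_eq_right h0]
    rw [max_eq_left (by linarith)]
    field_simp; ring
  have term_le : ∀ p : ℕ, (1 / (q * ρ)) * ov 0 x ((p : ℝ) / q) ρ ≤ 1 / q := by
    intro p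
    calc _ ≤ (1 / (q * ρ)) * ρ := by gcongr; exact ov_le_right hρ.le
      _ = _ := by field_simp
  have term_zero : ∀ p : ℕ, P + 1 ≤ p → (1 / (q * ρ)) * ov 0 x ((p : ℝ) / q) ρ = 0 := by
    intro p hp
    have hp1 : (P : ℝ) + 1 ≤ p := by exact_mod_cast hp
    by_contra h
    have h1 : ov 0 x ((p : ℝ) / q) ρ ≠ 0 := by intro h'; apply h; simp [h']
    have := (ov_pos h1).2
    rw [div_lt_iff₀ hqr] at this
    linarith
  have hlow : (P : ℝ) / q ≤ mm q ρ 0 x := by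
    calc (P : ℝ) / q = ∑ p ∈ Finset.range P, (1 / (q * ρ)) * ov 0 x ((p : ℝ) / q) ρ := by
          rw [Finset.sum_congr rfl (fun p hp => term_full p (Finset.mem_range.1 hp))]
          simp [div_eq_mul_inv]
      _ ≤ _ := by
          refine Finset.sum_le_sum_of_subset_of_nonneg (Finset.range_mono hPq) fun p _ _ => ?_
          exact mul_nonneg (by positivity) (ov_nonneg _ _ _ _)
  have hup : mm q ρ 0 x ≤ ((P : ℝ) + 1) / q := by
    calc mm q ρ 0 x ≤ ∑ p ∈ Finset.range q, if p < P + 1 then (1 / (q:ℝ)) else 0 := by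
          refine Finset.sum_le_sum fun p _ => ?_
          split_ifs with h
          · exact term_le p
          · exact (term_zero p (by omega)).le
      _ = (((Finset.range q).filter (fun p => p < P + 1)).card : ℝ) * (1 / q) := by
          rw [← Finset.sum_filter, Finset.sum_const, nsmul_eq_mul]
      _ ≤ ((P + 1 : ℕ) : ℝ) * (1 / q) := by
          gcongr
          calc _ ≤ (Finset.range (P + 1)).card := Finset.card_le_card (by
                intro p hp; simp at hp ⊢; omega)
            _ = _ := Finset.card_range _
      _ = _ := by push_cast; ring
  have h3 : (P : ℝ) / q ≤ x := by rw [div_le_iff₀ hqr]; linarith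
  have h4 : x ≤ ((P : ℝ) + 1) / q := by rw [le_div_iff₀ hqr]; linarith
  have h5 : ((P : ℝ) + 1) / q = P / q + 1 / q := by ring
  rw [abs_le]; constructor <;> linarith

lemma mm_bounds (q : ℕ) (hq : 0 < q) (ρ : ℝ) (hρ : 0 < ρ) (hρq : ρ ≤ 1 / q) (a b : ℝ)
    (ha : 0 ≤ a) (hab : a ≤ b) (hb : b ≤ 1) : |mm q ρ a b - (b - a)| ≤ 2 / q := by
  have h : mm q ρ 0 b = mm q ρ 0 a + mm q ρ a b := by
    unfold mm
    rw [← Finset.sum_add_distrib]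
    refine Finset.sum_congr rfl fun p _ => ?_
    rw [ov_split ha hab]; ring
  have h1 := mm_zero_bounds q hq ρ hρ hρq a ha (hab.trans hb)
  have h2 := mm_zero_bounds q hq ρ hρ hρq b (ha.trans hab) hb
  have h3 : (2:ℝ) / q = 1 / q + 1 / q := by ring
  rw [abs_le] at *
  constructor <;> linarith

end WA

namespace WA

lemma psi_bound {d : ℕ} (t : Fin d → ℝ) (s0 : ℝ) (hs0 : 0 ≤ s0) (hsd : s0 ≤ d)
    (hk : ∀ k, s0 * (1 + t k) ≤ d + 1 + ∑ i, max (t k - t i) 0)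
    (l T : ℝ) (hl : 0 ≤ l) (hT : 0 ≤ T) :
    s0 * T ≤ (d + 1) * l + ∑ i, max (T - (1 + t i) * l) 0 := by
  rcases hl.eq_or_lt with h0 | hl
  · subst h0
    simp only [mul_zero, sub_zero, zero_add, max_eq_left hT, Finset.sum_const, Finset.card_univ,
      Fintype.card_fin, nsmul_eq_mul]
    gcongr
  set S : Finset (Fin d) := Finset.univ.filter (fun i => (1 + t i) * l ≤ T) with hS
  have memS : ∀ i, i ∈ S ↔ (1 + t i) * l ≤ T := by intro i; simp [hS]
  have hsum : ∑ i ∈ S, (T - (1 + t i) * l) ≤ ∑ i, max (T - (1 + t i) * l) 0 := by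
    calc _ ≤ ∑ i ∈ S, max (T - (1 + t i) * l) 0 := Finset.sum_le_sum fun i _ => le_max_left _ _
      _ ≤ _ := Finset.sum_le_sum_of_subset_of_nonneg (Finset.subset_univ _)
        fun i _ _ => le_max_right _ _
  have main : ∀ k, (∀ i ∈ S, t i ≤ t k) → (∀ i ∉ S, t k ≤ t i) →
      s0 * ((1 + t k) * l) ≤ (d + 1) * l + ∑ i ∈ S, ((1 + t k) * l - (1 + t i) * l) := by
    intro k h1 h2
    have e : ∑ i, max (t k - t i) 0 = ∑ i ∈ S, (t k - t i) := by
      rw [← Finset.sum_subset (Finset.subset_univ S)]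
      · exact Finset.sum_congr rfl fun i hi => max_eq_left (by linarith [h1 i hi])
      · exact fun i _ hi => max_eq_right (by linarith [h2 i hi])
    have e2 : ∑ i ∈ S, ((1 + t k) * l - (1 + t i) * l) = (∑ i ∈ S, (t k - t i)) * l := by
      rw [Finset.sum_mul]; exact Finset.sum_congr rfl fun i _ => by ring
    rw [e2, ← e]
    have := mul_le_mul_of_nonneg_right (hk k) hl.le
    linarith
  have shift : ∀ u : ℝ, ∑ i ∈ S, (T - (1 + t i) * l) =
      ∑ i ∈ S, (u - (1 + t i) * l) + S.card * (T - u) := by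
    intro u
    rw [← nsmul_eq_mul, ← Finset.sum_const, ← Finset.sum_add_distrib]
    exact Finset.sum_congr rfl fun i _ => by ring
  by_cases hc : s0 ≤ S.card
  · rcases S.eq_empty_or_nonempty with he | hne
    · rw [he] at hc
      have : s0 = 0 := le_antisymm (by simpa using hc) hs0
      rw [this, zero_mul]
      exact add_nonneg (by positivity) (Finset.sum_nonneg fun i _ => le_max_right _ _)
    · obtain ⟨k, hkS, hkmax⟩ := S.exists_max_image t hne
      have hkT := (memS k).1 hkS
      have := main k hkmax (fun i hi => by
        have : T < (1 + t i) * l := by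
          by_contra h; exact hi ((memS i).2 (not_lt.1 h))
        have h3 : (1 + t k) * l < (1 + t i) * l := by linarith
        have := lt_of_mul_lt_mul_right h3 hl.le
        linarith)
      rw [shift ((1 + t k) * l)] at hsum
      nlinarith
  · push Not at hc
    have hne : Sᶜ.Nonempty := by
      rw [Finset.nonempty_iff_ne_empty]
      intro h
      rw [Finset.compl_eq_empty_iff] at h
      rw [h] at hc
      simp at hc
      linarith
    obtain ⟨k, hkS, hkmin⟩ := Sᶜ.exists_min_image t hne
    have hkT : T < (1 + t k) * l := by
      by_contra h; exact (Finset.mem_compl.1 hkS) ((memS k).2 (not_lt.1 h))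
    have := main k (fun i hi => by
        have h2 := (memS i).1 hi
        have h3 : (1 + t i) * l < (1 + t k) * l := by linarith
        have := lt_of_mul_lt_mul_right h3 hl.le
        linarith) (fun i hi => hkmin i (Finset.mem_compl.2 hi))
    rw [shift ((1 + t k) * l)] at hsum
    nlinarith

lemma phi_bound {d : ℕ} (t : Fin d → ℝ) (s0 : ℝ) (hs0 : 0 ≤ s0) (hsd : s0 ≤ d)
    (hk : ∀ k, s0 * (1 + t k) ≤ d + 1 + ∑ i, max (t k - t i) 0)
    (lam ε : ℝ) (hlam : 0 ≤ lam) (hε : 0 ≤ ε) (hsum : ∑ i, min (t i) lam = 1 - ε)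
    (l T : ℝ) (hl : 0 ≤ l) (hT : 0 ≤ T) :
    (s0 - ε) * T ≤ ∑ i, (max (T - (1 + t i) * l) 0 + min T ((1 + min (t i) lam) * l)) := by
  by_cases hc : T ≤ (1 + lam) * l
  · calc (s0 - ε) * T ≤ d * T := by nlinarith
      _ = ∑ i : Fin d, T := by simp
      _ ≤ _ := by
        refine Finset.sum_le_sum fun i _ => ?_
        rcases le_total (t i) lam with h | h
        · rw [min_eq_left h]
          rcases le_total T ((1 + t i) * l) with h2 | h2
          · rw [min_eq_left h2]; linarith [le_max_right (T - (1 + t i) * l) 0]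
          · rw [min_eq_right h2]; linarith [le_max_left (T - (1 + t i) * l) 0]
        · rw [min_eq_right h, min_eq_left hc]; linarith [le_max_right (T - (1 + t i) * l) 0]
  · push Not at hc
    have h1 : ∀ i, min T ((1 + min (t i) lam) * l) = (1 + min (t i) lam) * l := by
      intro i
      apply min_eq_right
      have : min (t i) lam ≤ lam := min_le_right _ _
      nlinarith
    simp only [h1]
    rw [Finset.sum_add_distrib, ← Finset.sum_mul, Finset.sum_add_distrib, hsum]
    have := psi_bound t s0 hs0 hsd hk l T hl hT
    simp only [Finset.sum_const, Finset.card_univ, Fintype.card_fin, nsmul_eq_mul, mul_one]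
    have hlT : l ≤ T := by nlinarith
    nlinarith

lemma prod_bound {d : ℕ} (t : Fin d → ℝ) (s0 : ℝ) (hs0 : 0 ≤ s0) (hsd : s0 ≤ d)
    (hk : ∀ k, s0 * (1 + t k) ≤ d + 1 + ∑ i, max (t k - t i) 0)
    (lam ε : ℝ) (hlam : 0 ≤ lam) (hε : 0 ≤ ε) (hsum : ∑ i, min (t i) lam = 1 - ε)
    (X r : ℝ) (hX : 1 ≤ X) (hr : 0 < r) (hr1 : r ≤ 1) :
    ∏ i, (min 1 (r / X ^ (-(1 + t i))) * max r (X ^ (-(1 + min (t i) lam)))) ≤ r ^ (s0 - ε) := by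
  have hX0 : 0 < X := by linarith
  have hl : 0 ≤ log X := log_nonneg hX
  have hT : 0 ≤ -log r := by linarith [log_nonpos hr.le hr1]
  have key := phi_bound t s0 hs0 hsd hk lam ε hlam hε hsum (log X) (-log r) hl hT
  have e : ∀ i, min 1 (r / X ^ (-(1 + t i))) * max r (X ^ (-(1 + min (t i) lam))) =
      exp (-(max (-log r - (1 + t i) * log X) 0 + min (-log r) ((1 + min (t i) lam) * log X))) := by
    intro i
    rw [neg_add (max _ _), exp_add]
    congr 1
    · rw [← min_neg_neg, neg_zero, exp_monotone.map_min, exp_zero, min_comm]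
      congr 1
      rw [rpow_def_of_pos hX0]
      nth_rw 1 [← exp_log hr]
      rw [← exp_sub]; congr 1; ring
    · rw [← max_neg_neg, exp_monotone.map_max, neg_neg, exp_log hr]
      congr 1
      rw [rpow_def_of_pos hX0]; congr 1; ring
  rw [Finset.prod_congr rfl (fun i _ => e i), ← exp_sum, rpow_def_of_pos hr, exp_le_exp,
    Finset.sum_neg_distrib]
  linarith

lemma exists_lam {d : ℕ} (t : Fin d → ℝ) (ht : ∀ i, 0 < t i) (hsum : 1 < ∑ i, t i)
    (ε : ℝ) (hε : 0 < ε) (hε1 : ε < 1) :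
    ∃ lam, 0 ≤ lam ∧ ∑ i, min (t i) lam = 1 - ε := by
  have hcont : ContinuousOn (fun lam : ℝ => ∑ i, min (t i) lam) (Icc 0 1) := by
    fun_prop
  have h0 : (fun lam : ℝ => ∑ i, min (t i) lam) 0 = 0 := by
    simp only
    exact Finset.sum_eq_zero fun i _ => min_eq_right (ht i).le
  have h1 : 1 ≤ (fun lam : ℝ => ∑ i, min (t i) lam) 1 := by
    simp only
    by_cases hc : ∃ i, 1 ≤ t i
    · obtain ⟨i, hi⟩ := hc
      calc (1:ℝ) = min (t i) 1 := (min_eq_right hi).symm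
        _ ≤ _ := Finset.single_le_sum (f := fun i => min (t i) 1)
          (fun j _ => le_min (ht j).le zero_le_one) (Finset.mem_univ i)
    · push Not at hc
      rw [Finset.sum_congr rfl fun i _ => min_eq_left (hc i).le]
      exact hsum.le
  have := intermediate_value_Icc (zero_le_one) hcont
  simp only at h0 h1
  rw [h0] at this
  obtain ⟨lam, hl, he⟩ := this (show 1 - ε ∈ Icc (0:ℝ) _ from ⟨by linarith, by linarith⟩)
  exact ⟨lam, hl.1, he⟩

lemma gcd_sum (N : ℕ) (F : ℕ → ℝ) (hF : ∀ g, 0 ≤ F g) :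
    ∑ q ∈ Finset.Ioc N (2 * N), ∑ q' ∈ Finset.Ioc N (2 * N), F (Nat.gcd q q') ≤
      ∑ g ∈ Finset.Icc 1 (2 * N), (2 * N / g : ℝ) ^ 2 * F g := by
  have h1 : ∀ q ∈ Finset.Ioc N (2 * N), ∀ q' ∈ Finset.Ioc N (2 * N), F (Nat.gcd q q') ≤
      ∑ g ∈ Finset.Icc 1 (2 * N), (if g ∣ q then 1 else 0) * (if g ∣ q' then 1 else 0) * F g := by
    intro q hq q' hq'
    simp only [Finset.mem_Ioc] at hq hq'
    have hm : Nat.gcd q q' ∈ Finset.Icc 1 (2 * N) := by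
      simp only [Finset.mem_Icc]
      exact ⟨Nat.gcd_pos_of_pos_left _ (by omega),
        (Nat.gcd_le_left _ (by omega)).trans hq.2⟩
    refine le_trans ?_ (Finset.single_le_sum (f := fun g => (if g ∣ q then (1:ℝ) else 0) *
      (if g ∣ q' then 1 else 0) * F g) ?_ hm)
    · simp [Nat.gcd_dvd_left, Nat.gcd_dvd_right]
    · intro g _
      exact mul_nonneg (by split_ifs <;> simp) (hF g)
  calc _ ≤ ∑ q ∈ Finset.Ioc N (2 * N), ∑ q' ∈ Finset.Ioc N (2 * N),
        ∑ g ∈ Finset.Icc 1 (2 * N), (if g ∣ q then (1:ℝ) else 0) * (if g ∣ q' then 1 else 0) * F g :=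
        Finset.sum_le_sum fun q hq => Finset.sum_le_sum fun q' hq' => h1 q hq q' hq'
    _ = ∑ g ∈ Finset.Icc 1 (2 * N), (∑ q ∈ Finset.Ioc N (2 * N), (if g ∣ q then (1:ℝ) else 0)) ^ 2
          * F g := by
        rw [Finset.sum_congr rfl fun q _ => Finset.sum_comm, Finset.sum_comm]
        refine Finset.sum_congr rfl fun g _ => ?_
        rw [sq, Finset.sum_mul_sum, Finset.sum_mul]
        refine Finset.sum_congr rfl fun q _ => ?_
        rw [Finset.sum_mul]
    _ ≤ _ := by
        refine Finset.sum_le_sum fun g hg => ?_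
        simp only [Finset.mem_Icc] at hg
        refine mul_le_mul_of_nonneg_right ?_ (hF g)
        have hnn : (0:ℝ) ≤ ∑ q ∈ Finset.Ioc N (2 * N), (if g ∣ q then (1:ℝ) else 0) :=
          Finset.sum_nonneg fun q _ => by split_ifs <;> simp
        refine pow_le_pow_left₀ hnn ?_ 2
        rw [← Finset.sum_filter, Finset.sum_const, nsmul_eq_mul, mul_one]
        have : ((Finset.Ioc N (2 * N)).filter (fun q => g ∣ q)).card ≤ 2 * N / g := by
          rw [← Nat.Ioc_filter_dvd_card_eq_div]
          refine Finset.card_le_card ?_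
          intro q hq
          simp only [Finset.mem_filter, Finset.mem_Ioc] at hq ⊢
          exact ⟨⟨by omega, hq.1.2⟩, hq.2⟩
        calc _ ≤ ((2 * N / g : ℕ) : ℝ) := by exact_mod_cast this
          _ ≤ ((2 * N : ℕ) : ℝ) / g := Nat.cast_div_le
          _ = _ := by push_cast; rfl

/-- radii -/
noncomputable def rho {d : ℕ} (t : Fin d → ℝ) (N : ℕ) (i : Fin d) : ℝ :=
  ((2 * N : ℕ) : ℝ) ^ (-(1 + t i)) / 2

lemma rho_pos {d : ℕ} (t : Fin d → ℝ) (N : ℕ) (hN : 1 ≤ N) (i : Fin d) : 0 < rho t N i := by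
  unfold rho
  have : (0:ℝ) < ((2 * N : ℕ) : ℝ) := by exact_mod_cast (by omega : 0 < 2 * N)
  positivity

lemma term_bound (N : ℕ) (hN : 1 ≤ N) (g q q' : ℕ) (hg : 1 ≤ g) (hg2 : g ≤ 2 * N)
    (hq : N ≤ q) (hq' : N ≤ q') (r t a : ℝ)
    (hr : 0 < r) (hat : a ≤ t) (ha1 : a ≤ 1) (ha0 : 0 ≤ a) :
    min 1 (r / (((2 * N : ℕ) : ℝ) ^ (-(1 + t)) / 2)) *
      ((g:ℝ) / (q * q') + 2 * (r + ((2 * N : ℕ) : ℝ) ^ (-(1 + t)) / 2)) ≤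
    16 * (g:ℝ) ^ a * (min 1 (r / ((2 * N : ℕ) : ℝ) ^ (-(1 + t))) *
      max r (((2 * N : ℕ) : ℝ) ^ (-(1 + a)))) := by
  set X : ℝ := ((2 * N : ℕ) : ℝ) with hX
  have hNr : (1:ℝ) ≤ N := by exact_mod_cast hN
  have hX2 : X = 2 * N := by rw [hX]; push_cast; ring
  have hX0 : 0 < X := by rw [hX2]; linarith
  have hX1 : 1 ≤ X := by rw [hX2]; linarith
  set P := X ^ (-(1 + t)) with hP
  set η := X ^ (-(1 + a)) with hη
  have hP0 : 0 < P := rpow_pos_of_pos hX0 _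
  have hη0 : 0 < η := rpow_pos_of_pos hX0 _
  have hgr : (1:ℝ) ≤ g := by exact_mod_cast hg
  have hgX : (g:ℝ) ≤ X := by rw [hX]; exact_mod_cast hg2
  have hPη : P ≤ η := rpow_le_rpow_of_exponent_le hX1 (by linarith)
  have hga : 1 ≤ (g:ℝ) ^ a := one_le_rpow hgr ha0
  have h1 : min 1 (r / (P / 2)) ≤ 2 * min 1 (r / P) := by
    have : r / (P / 2) = 2 * (r / P) := by field_simp
    rw [this]
    rcases le_total 1 (r / P) with h | h
    · rw [min_eq_left h]; exact (min_le_left _ _).trans (by norm_num)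
    · rw [min_eq_right h]; exact min_le_right _ _
  have h2 : (g:ℝ) / (q * q') ≤ 4 * ((g:ℝ) ^ a * η) := by
    have hqr : (N:ℝ) ≤ q := by exact_mod_cast hq
    have hqr' : (N:ℝ) ≤ q' := by exact_mod_cast hq'
    calc (g:ℝ) / (q * q') ≤ g / (N * N) := by gcongr
      _ = 4 * (g / X ^ (2:ℝ)) := by
          rw [hX2, rpow_two]; field_simp; norm_num
      _ ≤ 4 * ((g:ℝ) ^ a * η) := by
          gcongr
          rw [div_le_iff₀ (by positivity), hη, mul_assoc, ← rpow_add hX0]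
          have e : (g:ℝ) = (g:ℝ) ^ a * (g:ℝ) ^ (1 - a) := by
            rw [← rpow_add (by linarith)]; simp
          calc (g:ℝ) = (g:ℝ) ^ a * (g:ℝ) ^ (1 - a) := e
            _ ≤ (g:ℝ) ^ a * X ^ (1 - a) := by
              gcongr
            _ = _ := by congr 2; ring
  have h3 : r + P / 2 ≤ 2 * max r η := by
    linarith [le_max_left r η, le_max_right r η]
  have h4 : η ≤ max r η := le_max_right r η
  have hm0 : 0 < max r η := lt_max_of_lt_left hr
  have h5 : (g:ℝ) / (q * q') + 2 * (r + P / 2) ≤ 8 * ((g:ℝ) ^ a * max r η) := by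
    have : (g:ℝ) ^ a * η ≤ (g:ℝ) ^ a * max r η := by gcongr
    have : max r η ≤ (g:ℝ) ^ a * max r η := by nlinarith
    linarith
  have hmin : 0 ≤ min 1 (r / P) := le_min zero_le_one (by positivity)
  calc _ ≤ (2 * min 1 (r / P)) * (8 * ((g:ℝ) ^ a * max r η)) := by
        apply mul_le_mul h1 h5 (by positivity) (by positivity)
    _ = _ := by ring

lemma energy {d : ℕ} (t : Fin d → ℝ) (ht : ∀ i, 0 < t i) (s0 : ℝ) (hs0 : 0 ≤ s0) (hsd : s0 ≤ d)
    (htsum : 1 < ∑ i, t i)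
    (hk : ∀ k, s0 * (1 + t k) ≤ d + 1 + ∑ i, max (t k - t i) 0)
    (ε : ℝ) (hε : 0 < ε) (hε1 : ε < 1) :
    ∃ C : ℝ, 0 ≤ C ∧ ∀ N : ℕ, 1 ≤ N → ∀ n : ℕ, ∀ r : ℝ, 0 < r → r ≤ 1 →
      ∑ k ∈ Fintype.piFinset (fun _ : Fin d => Finset.range n),
        ((1 / (N:ℝ)) * ∑ q ∈ Finset.Ioc N (2 * N),
          ∏ i, mm q (rho t N i) (k i * r) ((k i + 1) * r)) ^ 2 ≤ C * r ^ (s0 - ε) := by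
  obtain ⟨lam, hlam, hlsum⟩ := exists_lam t ht htsum ε hε hε1
  have ha1 : ∀ i, min (t i) lam ≤ 1 := by
    intro i
    have : min (t i) lam ≤ ∑ i, min (t i) lam :=
      Finset.single_le_sum (f := fun i => min (t i) lam)
        (fun j _ => le_min (ht j).le hlam) (Finset.mem_univ i)
    linarith
  have hsm : Summable (fun g : ℕ => ((g:ℝ) ^ (1 + ε))⁻¹) :=
    Real.summable_nat_rpow_inv.2 (by linarith)
  refine ⟨4 * 16 ^ d * ∑' g : ℕ, ((g:ℝ) ^ (1 + ε))⁻¹, ?_, ?_⟩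
  · have : 0 ≤ ∑' g : ℕ, ((g:ℝ) ^ (1 + ε))⁻¹ := tsum_nonneg fun g => by positivity
    positivity
  intro N hN n r hr hr1
  have hNr : (1:ℝ) ≤ N := by exact_mod_cast hN
  set u : ℕ → ℕ → Fin d → ℝ := fun q k i => mm q (rho t N i) (k * r) ((k + 1) * r) with hu
  have e1 : ∀ k : Fin d → ℕ, ((1 / (N:ℝ)) * ∑ q ∈ Finset.Ioc N (2 * N),
          ∏ i, mm q (rho t N i) (k i * r) ((k i + 1) * r)) ^ 2 =
      (1 / (N:ℝ)) ^ 2 * ∑ q ∈ Finset.Ioc N (2 * N), ∑ q' ∈ Finset.Ioc N (2 * N),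
        ∏ i, (u q (k i) i * u q' (k i) i) := by
    intro k
    rw [mul_pow, sq (∑ q ∈ Finset.Ioc N (2 * N), _), Finset.sum_mul_sum]
    simp only [hu, Finset.prod_mul_distrib]
  have hx : (0:ℝ) ≤ r ^ (s0 - ε) := rpow_nonneg hr.le _
  have hbd : ∀ q ∈ Finset.Ioc N (2 * N), ∀ q' ∈ Finset.Ioc N (2 * N),
      ∑ k ∈ Fintype.piFinset (fun _ : Fin d => Finset.range n), ∏ i, (u q (k i) i * u q' (k i) i) ≤
      16 ^ d * (Nat.gcd q q' : ℝ) ^ (1 - ε) * r ^ (s0 - ε) := by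
    intro q hq q' hq'
    simp only [Finset.mem_Ioc] at hq hq'
    rw [← Finset.prod_univ_sum (fun _ : Fin d => Finset.range n) (fun i k => u q k i * u q' k i)]
    have hgpos : 1 ≤ Nat.gcd q q' := Nat.gcd_pos_of_pos_left _ (by omega)
    have hgle : Nat.gcd q q' ≤ 2 * N := (Nat.gcd_le_left _ (by omega)).trans hq.2
    calc _ ≤ ∏ i, (16 * (Nat.gcd q q' : ℝ) ^ (min (t i) lam) *
        (min 1 (r / ((2 * N : ℕ) : ℝ) ^ (-(1 + t i))) *
          max r (((2 * N : ℕ) : ℝ) ^ (-(1 + min (t i) lam))))) := by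
          refine Finset.prod_le_prod (fun i _ => Finset.sum_nonneg fun k _ =>
            mul_nonneg (mm_nonneg _ _ _ _ (rho_pos t N hN i).le)
              (mm_nonneg _ _ _ _ (rho_pos t N hN i).le)) fun i _ => ?_
          refine (one_dim_energy q q' (by omega) (by omega) n r (rho t N i) hr
            (rho_pos t N hN i)).trans ?_
          exact term_bound N hN _ q q' hgpos hgle hq.1.le hq'.1.le r (t i) _ hr
            (min_le_left _ _) (ha1 i) (le_min (ht i).le hlam)
      _ = 16 ^ d * (Nat.gcd q q' : ℝ) ^ (1 - ε) *
          ∏ i, (min 1 (r / ((2 * N : ℕ) : ℝ) ^ (-(1 + t i))) *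
          max r (((2 * N : ℕ) : ℝ) ^ (-(1 + min (t i) lam)))) := by
          rw [Finset.prod_mul_distrib, Finset.prod_mul_distrib, Finset.prod_const,
            Finset.card_univ, Fintype.card_fin,
            ← rpow_sum_of_pos (by exact_mod_cast hgpos), hlsum]
      _ ≤ _ := by
          gcongr
          exact prod_bound t s0 hs0 hsd hk lam ε hlam hε.le hlsum _ r
            (by exact_mod_cast (by omega : 1 ≤ 2 * N)) hr hr1
  rw [Finset.sum_congr rfl fun k _ => e1 k, ← Finset.mul_sum, Finset.sum_comm,
    Finset.sum_congr rfl fun q _ => Finset.sum_comm]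
  calc _ ≤ (1 / (N:ℝ)) ^ 2 * ∑ q ∈ Finset.Ioc N (2 * N), ∑ q' ∈ Finset.Ioc N (2 * N),
        (fun g : ℕ => 16 ^ d * (g : ℝ) ^ (1 - ε) * r ^ (s0 - ε)) (Nat.gcd q q') := by
        gcongr with q hq q' hq'
        exact hbd q hq q' hq'
    _ ≤ (1 / (N:ℝ)) ^ 2 * ∑ g ∈ Finset.Icc 1 (2 * N), (2 * N / g : ℝ) ^ 2 *
        (16 ^ d * (g : ℝ) ^ (1 - ε) * r ^ (s0 - ε)) := by
        gcongr
        exact gcd_sum N (fun g : ℕ => 16 ^ d * (g : ℝ) ^ (1 - ε) * r ^ (s0 - ε)) (fun g => by positivity)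
    _ = 4 * 16 ^ d * (∑ g ∈ Finset.Icc 1 (2 * N), ((g:ℝ) ^ (1 + ε))⁻¹) * r ^ (s0 - ε) := by
        rw [Finset.mul_sum, Finset.mul_sum, Finset.sum_mul]
        refine Finset.sum_congr rfl fun g hg => ?_
        simp only [Finset.mem_Icc] at hg
        have hg0 : (0:ℝ) < g := by exact_mod_cast hg.1
        have : ((g:ℝ) ^ (1 + ε))⁻¹ = (g:ℝ) ^ (1 - ε) / g ^ 2 := by
          rw [← rpow_neg hg0.le, ← rpow_two, ← rpow_sub hg0]; congr 1; ring
        rw [this]; field_simp; norm_num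
    _ ≤ _ := by
        gcongr
        exact hsm.sum_le_tsum _ (fun g _ => by positivity)

end WA

namespace WA

/-- half-open box -/
def box {d : ℕ} (a b : Fin d → ℝ) : Set (Fin d → ℝ) := Set.pi univ (fun i => Ico (a i) (b i))

/-- indicator function of a box -/
noncomputable def boxInd {d : ℕ} (a b : Fin d → ℝ) : (Fin d → ℝ) → ℝ :=
  (box a b).indicator (fun _ => (1:ℝ))

/-- step functions on boxes in the unit cube -/
def boxFun (d : ℕ) : Submodule ℝ ((Fin d → ℝ) → ℝ) :=
  Submodule.span ℝ {f | ∃ a b : Fin d → ℝ, (∀ i, a i ∈ Icc (0:ℝ) 1) ∧ (∀ i, b i ∈ Icc (0:ℝ) 1) ∧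
    f = boxInd a b}

lemma mem_box {d : ℕ} (a b x : Fin d → ℝ) : x ∈ box a b ↔ ∀ i, a i ≤ x i ∧ x i < b i := by
  simp [box, Set.mem_pi]

lemma box_meas {d : ℕ} (a b : Fin d → ℝ) : MeasurableSet (box a b) :=
  MeasurableSet.univ_pi fun _ => measurableSet_Ico

lemma boxInd_mem {d : ℕ} (a b : Fin d → ℝ) (ha : ∀ i, a i ∈ Icc (0:ℝ) 1)
    (hb : ∀ i, b i ∈ Icc (0:ℝ) 1) : boxInd a b ∈ boxFun d :=
  Submodule.subset_span ⟨a, b, ha, hb, rfl⟩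

lemma boxInd_nonneg {d : ℕ} (a b x : Fin d → ℝ) : 0 ≤ boxInd a b x :=
  Set.indicator_nonneg (fun _ _ => zero_le_one) _

lemma boxInd_le_one {d : ℕ} (a b x : Fin d → ℝ) : boxInd a b x ≤ 1 := by
  unfold boxInd
  by_cases h : x ∈ box a b <;> simp [h]

lemma boxInd_of_mem {d : ℕ} {a b x : Fin d → ℝ} (h : x ∈ box a b) : boxInd a b x = 1 := by
  simp [boxInd, h]

lemma mem_of_boxInd {d : ℕ} {a b x : Fin d → ℝ} (h : boxInd a b x ≠ 0) : x ∈ box a b := by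
  by_contra h'
  exact h (by simp [boxInd, h'])

lemma boxInd_mul {d : ℕ} (a b a' b' : Fin d → ℝ) :
    boxInd a b * boxInd a' b' = boxInd (fun i => max (a i) (a' i)) (fun i => min (b i) (b' i)) := by
  unfold boxInd
  rw [show (box (fun i => max (a i) (a' i)) (fun i => min (b i) (b' i))) = box a b ∩ box a' b' by
    ext x; simp only [mem_box, Set.mem_inter_iff, max_le_iff, lt_min_iff]
    constructor
    · intro h; exact ⟨fun i => ⟨(h i).1.1, (h i).2.1⟩, fun i => ⟨(h i).1.2, (h i).2.2⟩⟩
    · rintro ⟨h1, h2⟩ i; exact ⟨⟨(h1 i).1, (h2 i).1⟩, (h1 i).2, (h2 i).2⟩]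
  ext x
  by_cases h : x ∈ box a b <;> by_cases h' : x ∈ box a' b' <;> simp [h, h']

lemma boxFun_mul {d : ℕ} {f g : (Fin d → ℝ) → ℝ} (hf : f ∈ boxFun d) (hg : g ∈ boxFun d) :
    f * g ∈ boxFun d := by
  have h := Submodule.mul_mem_mul hf hg
  unfold boxFun at h
  rw [Submodule.span_mul_span] at h
  refine Submodule.span_mono ?_ h
  rintro _ ⟨_, ⟨a, b, ha, hb, rfl⟩, _, ⟨a', b', ha', hb', rfl⟩, rfl⟩
  refine ⟨_, _, ?_, ?_, boxInd_mul a b a' b'⟩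
  · intro i; exact ⟨le_max_of_le_left (ha i).1, max_le (ha i).2 (ha' i).2⟩
  · intro i; exact ⟨le_min (hb i).1 (hb' i).1, min_le_of_left_le (hb i).2⟩

lemma box_vol {d : ℕ} (a b : Fin d → ℝ) : volume (box a b) < ⊤ := by
  unfold box
  rw [Real.volume_pi_Ico]
  exact ENNReal.prod_lt_top fun i _ => ENNReal.ofReal_lt_top

lemma boxInd_integrable {d : ℕ} (a b : Fin d → ℝ) : Integrable (boxInd a b) :=
  (integrable_indicator_iff (box_meas a b)).2 (integrableOn_const (box_vol a b).ne)

lemma boxFun_integrable {d : ℕ} {f : (Fin d → ℝ) → ℝ} (hf : f ∈ boxFun d) : Integrable f := by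
  induction hf using Submodule.span_induction with
  | mem f h => obtain ⟨a, b, _, _, rfl⟩ := h; exact boxInd_integrable a b
  | zero => exact integrable_zero _ _ _
  | add f g _ _ h1 h2 => exact h1.add h2
  | smul c f _ h => exact h.smul c

lemma boxFun_bounded {d : ℕ} {f : (Fin d → ℝ) → ℝ} (hf : f ∈ boxFun d) :
    ∃ M, 0 ≤ M ∧ ∀ x, |f x| ≤ M := by
  induction hf using Submodule.span_induction with
  | mem f h =>
    obtain ⟨a, b, _, _, rfl⟩ := h
    exact ⟨1, zero_le_one, fun x => by
      rw [abs_of_nonneg (boxInd_nonneg _ _ _)]; exact boxInd_le_one _ _ _⟩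
  | zero => exact ⟨0, le_rfl, fun x => by simp⟩
  | add f g _ _ h1 h2 =>
    obtain ⟨M, hM, h1⟩ := h1
    obtain ⟨M', hM', h2⟩ := h2
    exact ⟨M + M', by positivity, fun x => (abs_add_le _ _).trans (add_le_add (h1 x) (h2 x))⟩
  | smul c f _ h =>
    obtain ⟨M, hM, h1⟩ := h
    exact ⟨|c| * M, by positivity, fun x => by
      simp only [Pi.smul_apply, smul_eq_mul, abs_mul]; gcongr; exact h1 x⟩

lemma boxFun_support {d : ℕ} {f : (Fin d → ℝ) → ℝ} (hf : f ∈ boxFun d) (x : Fin d → ℝ)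
    (hx : f x ≠ 0) : ∀ i, 0 ≤ x i ∧ x i < 1 := by
  induction hf using Submodule.span_induction with
  | mem f h =>
    obtain ⟨a, b, ha, hb, rfl⟩ := h
    have := (mem_box _ _ _).1 (mem_of_boxInd hx)
    exact fun i => ⟨(ha i).1.trans (this i).1, (this i).2.trans_le (hb i).2⟩
  | zero => simp at hx
  | add f g _ _ h1 h2 =>
    by_cases h : f x = 0
    · exact h2 (by intro h'; apply hx; simp [h, h'])
    · exact h1 h
  | smul c f _ h => exact h (by intro h'; apply hx; simp [h'])

lemma integral_boxInd {d : ℕ} (a b : Fin d → ℝ) : ∫ x, boxInd a b x = ∏ i, max (b i - a i) 0 := by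
  unfold boxInd
  rw [integral_indicator (box_meas a b), setIntegral_const, smul_eq_mul, mul_one, Measure.real]
  unfold box
  rw [Real.volume_pi_Ico, ENNReal.toReal_prod]
  refine Finset.prod_congr rfl fun i _ => ?_
  rw [ENNReal.toReal_ofReal']

lemma integral_boxInd_mul {d : ℕ} (a b P ρ : Fin d → ℝ) :
    ∫ x, boxInd a b x * boxInd P (fun i => P i + ρ i) x = ∏ i, ov (a i) (b i) (P i) (ρ i) := by
  have h := boxInd_mul a b P (fun i => P i + ρ i)
  have h2 : ∀ x, boxInd a b x * boxInd P (fun i => P i + ρ i) x =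
    boxInd (fun i => max (a i) (P i)) (fun i => min (b i) (P i + ρ i)) x := fun x => congrFun h x
  simp only [h2, integral_boxInd, ov_eq]

/-- approximating densities -/
noncomputable def gN {d : ℕ} (t : Fin d → ℝ) (N : ℕ) : (Fin d → ℝ) → ℝ :=
  (1 / (N:ℝ)) • ∑ q ∈ Finset.Ioc N (2 * N), ∑ p ∈ Fintype.piFinset (fun _ : Fin d => Finset.range q),
    (∏ i, (1 / (q * rho t N i))) • boxInd (fun i => (p i : ℝ) / q) (fun i => (p i : ℝ) / q + rho t N i)

lemma rho_le {d : ℕ} (t : Fin d → ℝ) (ht : ∀ i, 0 < t i) (N q : ℕ) (hN : 1 ≤ N) (hq0 : 0 < q)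
    (hq : q ≤ 2 * N) (i : Fin d) : rho t N i ≤ 1 / q := by
  have hX1 : (1:ℝ) ≤ ((2 * N : ℕ) : ℝ) := by exact_mod_cast (by omega : 1 ≤ 2 * N)
  have hqr : (0:ℝ) < q := by exact_mod_cast hq0
  have hqX : (q:ℝ) ≤ ((2 * N : ℕ) : ℝ) := by exact_mod_cast hq
  unfold rho
  have h1 : ((2 * N : ℕ) : ℝ) ^ (-(1 + t i)) ≤ ((2 * N : ℕ) : ℝ) ^ (-1 : ℝ) :=
    rpow_le_rpow_of_exponent_le hX1 (by linarith [ht i])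
  rw [rpow_neg_one] at h1
  have h2 : (((2 * N : ℕ) : ℝ))⁻¹ ≤ 1 / q := by
    rw [← one_div]; gcongr
  have h3 : (0:ℝ) ≤ ((2 * N : ℕ) : ℝ) ^ (-(1 + t i)) := by positivity
  linarith

lemma gN_mem {d : ℕ} (t : Fin d → ℝ) (ht : ∀ i, 0 < t i) (N : ℕ) (hN : 1 ≤ N) :
    gN t N ∈ boxFun d := by
  unfold gN
  refine Submodule.smul_mem _ _ (Submodule.sum_mem _ fun q hq => Submodule.sum_mem _ fun p hp =>
    Submodule.smul_mem _ _ (boxInd_mem _ _ ?_ ?_))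
  all_goals
    intro i
    simp only [Finset.mem_Ioc] at hq
    have hpi : p i < q := by simpa using (Fintype.mem_piFinset.1 hp) i
    have hqr : (0:ℝ) < q := by exact_mod_cast (by omega : 0 < q)
    have hp1 : (p i : ℝ) + 1 ≤ q := by exact_mod_cast hpi
    have h0 : (0:ℝ) ≤ (p i : ℝ) / q := by positivity
    have h1 : (p i : ℝ) / q + 1 / q ≤ 1 := by
      rw [← add_div, div_le_one hqr]; exact hp1
    have h2 := rho_le t ht N q hN (by omega) hq.2 i
    have h3 := rho_pos t N hN i
    exact ⟨by linarith, by linarith⟩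

lemma gN_nonneg {d : ℕ} (t : Fin d → ℝ) (N : ℕ) (hN : 1 ≤ N) (x : Fin d → ℝ) : 0 ≤ gN t N x := by
  unfold gN
  simp only [Pi.smul_apply, Finset.sum_apply, smul_eq_mul]
  refine mul_nonneg (by positivity) (Finset.sum_nonneg fun q _ => Finset.sum_nonneg fun p _ =>
    mul_nonneg (Finset.prod_nonneg fun i _ => ?_) (boxInd_nonneg _ _ _))
  have := rho_pos t N hN i
  positivity

lemma integral_boxInd_gN {d : ℕ} (t : Fin d → ℝ) (N : ℕ) (a b : Fin d → ℝ) :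
    ∫ x, boxInd a b x * gN t N x =
      (1 / (N:ℝ)) * ∑ q ∈ Finset.Ioc N (2 * N), ∏ i, mm q (rho t N i) (a i) (b i) := by
  have hinteg : ∀ P ρ : Fin d → ℝ,
      Integrable (fun x => boxInd a b x * boxInd P (fun i => P i + ρ i) x) := by
    intro P ρ
    have := boxInd_integrable (fun i => max (a i) (P i)) (fun i => min (b i) (P i + ρ i))
    rw [← boxInd_mul] at this
    exact this
  have e : ∀ x, boxInd a b x * gN t N x = (1 / (N:ℝ)) * ∑ q ∈ Finset.Ioc N (2 * N),
      ∑ p ∈ Fintype.piFinset (fun _ : Fin d => Finset.range q), (∏ i, (1 / (q * rho t N i))) *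
      (boxInd a b x * boxInd (fun i => (p i : ℝ) / q) (fun i => (p i : ℝ) / q + rho t N i) x) := by
    intro x
    unfold gN
    simp only [Pi.smul_apply, Finset.sum_apply, smul_eq_mul]
    rw [mul_left_comm, Finset.mul_sum]
    congr 1
    refine Finset.sum_congr rfl fun q _ => ?_
    rw [Finset.mul_sum]
    exact Finset.sum_congr rfl fun p _ => by ring
  simp only [e]
  rw [integral_const_mul, integral_finsetSum]
  · congr 1
    refine Finset.sum_congr rfl fun q _ => ?_
    rw [integral_finsetSum]
    · unfold mm
      rw [Finset.prod_univ_sum]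
      refine Finset.sum_congr rfl fun p _ => ?_
      rw [integral_const_mul, integral_boxInd_mul, Finset.prod_mul_distrib]
    · exact fun p _ => (hinteg _ _).const_mul _
  · exact fun q _ => integrable_finsetSum _ fun p _ => (hinteg _ _).const_mul _

lemma mm_bounds' (q : ℕ) (hq : 0 < q) (ρ : ℝ) (hρ : 0 < ρ) (hρq : ρ ≤ 1 / q) (a b : ℝ)
    (ha : a ∈ Icc (0:ℝ) 1) (hb : b ∈ Icc (0:ℝ) 1) : |mm q ρ a b - max (b - a) 0| ≤ 2 / q := by
  rcases le_total a b with h | h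
  · rw [max_eq_left (by linarith)]
    exact mm_bounds q hq ρ hρ hρq a b ha.1 h hb.2
  · rw [max_eq_right (by linarith)]
    have : mm q ρ a b = 0 := by
      unfold mm ov
      refine Finset.sum_eq_zero fun p _ => ?_
      rw [Ico_eq_empty (not_lt.2 h)]; simp
    rw [this]; simp; positivity

lemma gN_tendsto_box {d : ℕ} (t : Fin d → ℝ) (ht : ∀ i, 0 < t i) (a b : Fin d → ℝ)
    (ha : ∀ i, a i ∈ Icc (0:ℝ) 1) (hb : ∀ i, b i ∈ Icc (0:ℝ) 1) :
    Filter.Tendsto (fun N => ∫ x, boxInd a b x * gN t N x) Filter.atTop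
      (nhds (∫ x, boxInd a b x)) := by
  simp only [integral_boxInd_gN, integral_boxInd]
  set c : Fin d → ℝ := fun i => max (b i - a i) 0 with hc
  rw [Metric.tendsto_atTop]
  intro ε hε
  have hcont : ContinuousAt (fun y : Fin d → ℝ => ∏ i, y i) c := by fun_prop
  rw [Metric.continuousAt_iff] at hcont
  obtain ⟨δ, hδ, h⟩ := hcont (ε / 2) (by positivity)
  obtain ⟨N0, hN0⟩ := exists_nat_gt (2 / δ)
  refine ⟨N0 + 1, fun N hN => ?_⟩
  have hN1 : 1 ≤ N := by omega
  have hNr : (0:ℝ) < N := by exact_mod_cast hN1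
  have hterm : ∀ q ∈ Finset.Ioc N (2 * N),
      |∏ i, mm q (rho t N i) (a i) (b i) - ∏ i, c i| ≤ ε / 2 := by
    intro q hq
    simp only [Finset.mem_Ioc] at hq
    have hqr : (0:ℝ) < q := by exact_mod_cast (by omega : 0 < q)
    have : dist (fun i => mm q (rho t N i) (a i) (b i)) c < δ := by
      rw [dist_pi_lt_iff hδ]
      intro i
      rw [Real.dist_eq]
      refine (mm_bounds' q (by omega) _ (rho_pos t N hN1 i) (rho_le t ht N q hN1 (by omega) hq.2 i)
        _ _ (ha i) (hb i)).trans_lt ?_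
      rw [div_lt_iff₀ hqr]
      rw [div_lt_iff₀ hδ] at hN0
      have : (N0 : ℝ) ≤ q := by exact_mod_cast (by omega : N0 ≤ q)
      nlinarith
    have := h this
    rw [Real.dist_eq] at this
    exact this.le
  have e : (1 / (N:ℝ)) * ∑ q ∈ Finset.Ioc N (2 * N), ∏ i, mm q (rho t N i) (a i) (b i) - ∏ i, c i
      = (1 / (N:ℝ)) * ∑ q ∈ Finset.Ioc N (2 * N),
        (∏ i, mm q (rho t N i) (a i) (b i) - ∏ i, c i) := by
    rw [Finset.sum_sub_distrib, Finset.sum_const, Nat.card_Ioc, nsmul_eq_mul, mul_sub]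
    congr 1
    rw [show 2 * N - N = N by omega]; field_simp
  rw [Real.dist_eq, e, abs_mul, abs_of_pos (by positivity : (0:ℝ) < 1 / N)]
  calc _ ≤ (1 / (N:ℝ)) * ∑ q ∈ Finset.Ioc N (2 * N), ε / 2 := by
        gcongr
        exact (Finset.abs_sum_le_sum_abs _ _).trans (Finset.sum_le_sum hterm)
    _ = ε / 2 := by
        rw [Finset.sum_const, Nat.card_Ioc, nsmul_eq_mul, show 2 * N - N = N by omega]
        field_simp
    _ < ε := by linarith

lemma gN_tendsto {d : ℕ} (t : Fin d → ℝ) (ht : ∀ i, 0 < t i) {f : (Fin d → ℝ) → ℝ}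
    (hf : f ∈ boxFun d) :
    Filter.Tendsto (fun N => ∫ x, f x * gN t N x) Filter.atTop (nhds (∫ x, f x)) := by
  induction hf using Submodule.span_induction with
  | mem f h => obtain ⟨a, b, ha, hb, rfl⟩ := h; exact gN_tendsto_box t ht a b ha hb
  | zero => simp
  | add f g hf hg h1 h2 =>
    have := h1.add h2
    simp only [Pi.add_apply]
    rw [integral_add (boxFun_integrable hf) (boxFun_integrable hg)]
    refine this.congr' ?_
    filter_upwards [Filter.eventually_ge_atTop 1] with N hN
    have e := integral_add (boxFun_integrable (boxFun_mul hf (gN_mem t ht N hN)))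
      (boxFun_integrable (boxFun_mul hg (gN_mem t ht N hN)))
    simp only [Pi.mul_apply] at e
    simp only [add_mul]
    exact e.symm
  | smul c f _ h =>
    simp only [Pi.smul_apply, smul_eq_mul, mul_assoc, integral_const_mul]
    exact h.const_mul c

lemma gN_closure {d : ℕ} (t : Fin d → ℝ) (N : ℕ) (x : Fin d → ℝ)
    (hx : x ∈ closure (Function.support (gN t N))) :
    ∃ q ∈ Finset.Ioc N (2 * N), ∃ p : Fin d → ℕ, ∀ i,
      (p i : ℝ) / q ≤ x i ∧ x i ≤ (p i : ℝ) / q + rho t N i := by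
  set Z : Set (Fin d → ℝ) := ⋃ q ∈ Finset.Ioc N (2 * N),
    ⋃ p ∈ Fintype.piFinset (fun _ : Fin d => Finset.range q),
      Set.pi univ (fun i => Icc ((p i : ℝ) / q) ((p i : ℝ) / q + rho t N i)) with hZ
  have hcl : IsClosed Z := by
    refine isClosed_biUnion_finset fun q _ => isClosed_biUnion_finset fun p _ => ?_
    exact isClosed_set_pi fun i _ => isClosed_Icc
  have hsub : Function.support (gN t N) ⊆ Z := by
    intro y hy
    by_contra hyZ
    apply hy
    unfold gN
    simp only [Pi.smul_apply, Finset.sum_apply, smul_eq_mul]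
    refine mul_eq_zero_of_right _ (Finset.sum_eq_zero fun q hq => Finset.sum_eq_zero fun p hp =>
      mul_eq_zero_of_right _ ?_)
    by_contra hne
    apply hyZ
    have := (mem_box _ _ _).1 (mem_of_boxInd hne)
    simp only [hZ, Set.mem_iUnion]
    exact ⟨q, hq, p, hp, fun i _ => ⟨(this i).1, (this i).2.le⟩⟩
  have := closure_minimal hsub hcl hx
  simp only [hZ, Set.mem_iUnion] at this
  obtain ⟨q, hq, p, _, h⟩ := this
  exact ⟨q, hq, p, fun i => h i (mem_univ i)⟩

end WA

namespace WA

/-- indicator of a dyadic cube -/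
noncomputable def cub {d : ℕ} (j : ℕ) (k : Fin d → ℕ) : (Fin d → ℝ) → ℝ :=
  boxInd (fun i => (k i : ℝ) * (1 / 2) ^ j) (fun i => ((k i : ℝ) + 1) * (1 / 2) ^ j)

/-- indices of dyadic cubes -/
def idx (d j : ℕ) : Finset (Fin d → ℕ) := Fintype.piFinset (fun _ : Fin d => Finset.range (2 ^ j))

/-- energy at a level -/
noncomputable def en {d : ℕ} (f : (Fin d → ℝ) → ℝ) (j : ℕ) : ℝ :=
  ∑ k ∈ idx d j, (∫ x, cub j k x * f x) ^ 2

/-- truncated dyadic energy -/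
noncomputable def En {d : ℕ} (s : ℝ) (J : ℕ) (f : (Fin d → ℝ) → ℝ) : ℝ :=
  ∑ j ∈ Finset.range J, ((2:ℝ) ^ s) ^ j * en f j

lemma mem_idx {d j : ℕ} (k : Fin d → ℕ) : k ∈ idx d j ↔ ∀ i, k i < 2 ^ j := by
  simp [idx]

lemma cub_mem {d j : ℕ} (k : Fin d → ℕ) (hk : k ∈ idx d j) : cub j k ∈ boxFun d := by
  rw [mem_idx] at hk
  have h2 : (0:ℝ) < (1 / 2) ^ j := by positivity
  have key : ∀ i, ((k i : ℝ) + 1) * (1 / 2) ^ j ≤ 1 := by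
    intro i
    have : ((k i : ℝ) + 1) ≤ 2 ^ j := by exact_mod_cast hk i
    calc ((k i : ℝ) + 1) * (1 / 2) ^ j ≤ 2 ^ j * (1 / 2) ^ j := by gcongr
      _ = 1 := by rw [← mul_pow]; norm_num
  refine boxInd_mem _ _ (fun i => ⟨by positivity, ?_⟩) (fun i => ⟨by positivity, key i⟩)
  nlinarith [key i]

lemma cub_nonneg {d j : ℕ} (k : Fin d → ℕ) (x : Fin d → ℝ) : 0 ≤ cub j k x := boxInd_nonneg _ _ _

lemma en_nonneg {d : ℕ} (f : (Fin d → ℝ) → ℝ) (j : ℕ) : 0 ≤ en f j :=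
  Finset.sum_nonneg fun _ _ => sq_nonneg _

lemma cub_int_nonneg {d j : ℕ} (k : Fin d → ℕ) {f : (Fin d → ℝ) → ℝ} (hf : ∀ x, 0 ≤ f x) :
    0 ≤ ∫ x, cub j k x * f x :=
  integral_nonneg fun x => mul_nonneg (cub_nonneg k x) (hf x)

lemma en_mul_le {d : ℕ} {f g : (Fin d → ℝ) → ℝ} (hf : f ∈ boxFun d) (hg : g ∈ boxFun d)
    (hf0 : ∀ x, 0 ≤ f x) (hg0 : ∀ x, 0 ≤ g x) (M : ℝ) (hM : ∀ x, f x ≤ M) (j : ℕ) :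
    en (f * g) j ≤ M ^ 2 * en g j := by
  unfold en
  rw [Finset.mul_sum]
  refine Finset.sum_le_sum fun k hk => ?_
  rw [← mul_pow]
  refine pow_le_pow_left₀ (cub_int_nonneg k fun x => mul_nonneg (hf0 x) (hg0 x)) ?_ 2
  rw [← integral_const_mul]
  refine integral_mono (boxFun_integrable (boxFun_mul (cub_mem k hk) (boxFun_mul hf hg)))
    ((boxFun_integrable (boxFun_mul (cub_mem k hk) hg)).const_mul M) fun x => ?_
  have h1 := cub_nonneg (j := j) k x
  have h2 := hg0 x
  simp only [Pi.mul_apply]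
  calc cub j k x * (f x * g x) ≤ cub j k x * (M * g x) := by gcongr; exact hM x
    _ = _ := by ring

lemma tail_sum (a : ℕ → ℝ) (ha : ∀ j, 0 ≤ a j) (A θ : ℝ) (hA : 0 ≤ A) (h0 : 0 ≤ θ) (h1 : θ < 1)
    (hle : ∀ j, a j ≤ A * θ ^ j) (J0 J : ℕ) :
    ∑ j ∈ Finset.range J, a j ≤ ∑ j ∈ Finset.range J0, a j + A * θ ^ J0 * (1 - θ)⁻¹ := by
  calc _ ≤ ∑ j ∈ Finset.range (J0 + J), a j :=
        Finset.sum_le_sum_of_subset_of_nonneg (Finset.range_mono (by omega)) fun j _ _ => ha j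
    _ = ∑ j ∈ Finset.range J0, a j + ∑ j ∈ Finset.range J, a (J0 + j) :=
        Finset.sum_range_add _ _ _
    _ ≤ ∑ j ∈ Finset.range J0, a j + ∑ j ∈ Finset.range J, (A * θ ^ J0) * θ ^ j := by
        gcongr with j hj
        refine (hle _).trans (le_of_eq ?_)
        rw [pow_add]; ring
    _ ≤ _ := by
        rw [← Finset.mul_sum]
        gcongr
        rw [← tsum_geometric_of_lt_one h0 h1]
        exact (summable_geometric_of_lt_one h0 h1).sum_le_tsum _ fun j _ => by positivity

/-- hypotheses on a sequence of densities -/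
structure Good {d : ℕ} (s' : ℝ) (g : ℕ → (Fin d → ℝ) → ℝ) (C : ℝ) : Prop where
  mem : ∀ N, 1 ≤ N → g N ∈ boxFun d
  nonneg : ∀ N, 1 ≤ N → ∀ x, 0 ≤ g N x
  conv : ∀ f ∈ boxFun d, Filter.Tendsto (fun N => ∫ x, f x * g N x) Filter.atTop (nhds (∫ x, f x))
  energy : ∀ N, 1 ≤ N → ∀ j, en (g N) j ≤ C * (((2:ℝ) ^ s')⁻¹) ^ j
  cnn : 0 ≤ C

lemma step_energy {d : ℕ} {s s' C : ℝ} (hss : s < s') {g : ℕ → (Fin d → ℝ) → ℝ} (hg : Good s' g C)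
    {f : (Fin d → ℝ) → ℝ} (hf : f ∈ boxFun d) (hf0 : ∀ x, 0 ≤ f x) (C1 δ : ℝ) (hδ : 0 < δ)
    (hC1 : ∀ J, En s J f ≤ C1) :
    ∀ᶠ N in Filter.atTop, ∀ J, En s J (f * g N) ≤ C1 + δ := by
  obtain ⟨M, hM0, hM⟩ := boxFun_bounded hf
  set θ : ℝ := (2:ℝ) ^ s * ((2:ℝ) ^ s')⁻¹ with hθ
  have h2s : (0:ℝ) < 2 ^ s := by positivity
  have h2s' : (0:ℝ) < 2 ^ s' := by positivity
  have hθ0 : 0 ≤ θ := by positivity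
  have hθ1 : θ < 1 := by
    rw [hθ, ← div_eq_mul_inv, div_lt_one h2s']
    exact rpow_lt_rpow_of_exponent_lt (by norm_num) hss
  have hlim : Filter.Tendsto (fun J0 : ℕ => M ^ 2 * C * θ ^ J0 * (1 - θ)⁻¹) Filter.atTop (nhds 0) := by
    have := ((tendsto_pow_atTop_nhds_zero_of_lt_one hθ0 hθ1).const_mul (M ^ 2 * C)).mul_const
      ((1 - θ)⁻¹)
    simpa using this
  obtain ⟨J0, hJ0⟩ := (hlim.eventually_lt_const (show (0:ℝ) < δ / 2 by positivity)).exists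
  have hconv : Filter.Tendsto (fun N => En s J0 (f * g N)) Filter.atTop (nhds (En s J0 f)) := by
    unfold En en
    refine tendsto_finsetSum _ fun j _ => Filter.Tendsto.const_mul _ (tendsto_finsetSum _ fun k hk => ?_)
    refine Filter.Tendsto.pow ?_ 2
    have := hg.conv _ (boxFun_mul (cub_mem k hk) hf)
    simpa [mul_assoc] using this
  filter_upwards [hconv.eventually_lt_const (show En s J0 f < En s J0 f + δ / 2 by linarith),
    Filter.eventually_ge_atTop 1] with N hN hN1 J
  have := tail_sum (fun j => ((2:ℝ) ^ s) ^ j * en (f * g N) j)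
    (fun j => mul_nonneg (by positivity) (en_nonneg _ _)) (M ^ 2 * C) θ
    (mul_nonneg (by positivity) hg.cnn) hθ0 hθ1 (fun j => ?_) J0 J
  · change En s J (f * g N) ≤ En s J0 (f * g N) + _ at this
    linarith [hC1 J0]
  · have h1 := en_mul_le hf (hg.mem N hN1) hf0 (hg.nonneg N hN1) M (fun x => (le_abs_self _).trans (hM x)) j
    have h2 := hg.energy N hN1 j
    calc ((2:ℝ) ^ s) ^ j * en (f * g N) j ≤ ((2:ℝ) ^ s) ^ j * (M ^ 2 * (C * (((2:ℝ) ^ s')⁻¹) ^ j)) := by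
          gcongr
          exact h1.trans (by gcongr)
      _ = _ := by rw [hθ, mul_pow]; ring

/-- invariant of the construction -/
structure Inv {d : ℕ} (s c C : ℝ) (f : (Fin d → ℝ) → ℝ) : Prop where
  mem : f ∈ boxFun d
  nonneg : ∀ x, 0 ≤ f x
  mass : c < ∫ x, f x
  energy : ∃ C' < C, ∀ J, En s J f ≤ C'

lemma step {d : ℕ} {s s' C : ℝ} (hss : s < s') {g : ℕ → (Fin d → ℝ) → ℝ} (hg : Good s' g C)
    {c C1 : ℝ} {f : (Fin d → ℝ) → ℝ} (hf : Inv s c C1 f) (n : ℕ) :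
    ∃ N, n ≤ N ∧ 1 ≤ N ∧ Inv s c C1 (f * g N) := by
  obtain ⟨C', hC', hE⟩ := hf.energy
  have h1 := step_energy hss hg hf.mem hf.nonneg C' ((C1 - C') / 2) (by linarith) hE
  have h2 := (hg.conv f hf.mem).eventually_const_lt hf.mass
  obtain ⟨N, hN⟩ := (((h1.and h2).and (Filter.eventually_ge_atTop n)).and
    (Filter.eventually_ge_atTop 1)).exists
  obtain ⟨⟨⟨a1, a2⟩, a3⟩, a4⟩ := hN
  exact ⟨N, a3, a4, boxFun_mul hf.mem (hg.mem N a4),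
    fun x => mul_nonneg (hf.nonneg x) (hg.nonneg N a4 x), a2, _, by linarith, a1⟩

lemma construct {d : ℕ} {s s' C : ℝ} (hss : s < s') {g : ℕ → (Fin d → ℝ) → ℝ} (hg : Good s' g C)
    {c C1 : ℝ} {f0 : (Fin d → ℝ) → ℝ} (hf : Inv s c C1 f0) :
    ∃ f : ℕ → (Fin d → ℝ) → ℝ, f 0 = f0 ∧ (∀ n, Inv s c C1 (f n)) ∧
      ∀ n, ∃ N, n ≤ N ∧ 1 ≤ N ∧ f (n + 1) = f n * g N := by
  choose! F hF using fun (f : (Fin d → ℝ) → ℝ) (n : ℕ) (hf : Inv s c C1 f) => step hss hg hf n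
  let f : ℕ → (Fin d → ℝ) → ℝ := fun n => Nat.rec f0 (fun n f => f * g (F f n)) n
  have hInv : ∀ n, Inv s c C1 (f n) := by
    intro n
    induction n with
    | zero => exact hf
    | succ n ih => exact (hF (f n) n ih).2.2
  exact ⟨f, rfl, hInv, fun n => ⟨F (f n) n, (hF (f n) n (hInv n)).1, (hF (f n) n (hInv n)).2.1, rfl⟩⟩

lemma sum_biUnion_le' {α β : Type*} [DecidableEq α] [DecidableEq β] (F : Finset α) (T : α → Finset β) (w : β → ℝ)
    (hw : ∀ b, 0 ≤ w b) : ∑ b ∈ F.biUnion T, w b ≤ ∑ a ∈ F, ∑ b ∈ T a, w b := by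
  induction F using Finset.induction_on with
  | empty => simp
  | insert a F ha ih =>
    rw [Finset.biUnion_insert, Finset.sum_insert ha]
    have := Finset.sum_union_inter (s₁ := T a) (s₂ := F.biUnion T) (f := w)
    have h2 : 0 ≤ ∑ b ∈ T a ∩ F.biUnion T, w b := Finset.sum_nonneg fun b _ => hw b
    linarith

/-- dyadic cubes meeting a neighbourhood of a small set -/
lemma small_cover {d : ℕ} (t : Set (Fin d → ℝ)) (j : ℕ) (hdiam : Metric.ediam t < ENNReal.ofReal ((1 / 2) ^ j)) :
    ∃ T : Finset (Fin d → ℕ), T ⊆ idx d j ∧ T.card ≤ 5 ^ d ∧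
      ∀ x ∈ Metric.thickening ((1 / 2) ^ j) t, (∀ i, 0 ≤ x i ∧ x i < 1) → ∃ k ∈ T, cub j k x = 1 := by
  set r : ℝ := (1 / 2) ^ j with hr
  have hr0 : 0 < r := by positivity
  have h2r : (2:ℝ) ^ j * r = 1 := by rw [hr, ← mul_pow]; norm_num
  rcases t.eq_empty_or_nonempty with rfl | ⟨y, hy⟩
  · exact ⟨∅, by simp, by simp, fun x hx => by simp at hx⟩
  set b : Fin d → ℤ := fun i => ⌊y i / r⌋ with hb
  refine ⟨Fintype.piFinset (fun i => (Finset.range (2 ^ j)).filter (fun k : ℕ => |(k:ℤ) - b i| ≤ 2)),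
    ?_, ?_, ?_⟩
  · intro k hk
    rw [Fintype.mem_piFinset] at hk
    rw [mem_idx]
    intro i
    have := hk i
    simp only [Finset.mem_filter, Finset.mem_range] at this
    exact this.1
  · rw [Fintype.card_piFinset]
    calc _ ≤ ∏ i : Fin d, 5 := by
          refine Finset.prod_le_prod' fun i _ => ?_
          calc _ ≤ (Finset.Icc (b i - 2) (b i + 2)).card := by
                refine Finset.card_le_card_of_injOn (fun k : ℕ => (k : ℤ)) ?_ ?_
                · intro k hk
                  simp only [Finset.coe_filter, Finset.mem_range, Set.mem_ofPred_eq, abs_le] at hk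
                  simp only [Finset.coe_Icc, Set.mem_Icc]
                  constructor <;> linarith [hk.2.1, hk.2.2]
                · intro a _ b _ h; simpa using h
            _ = 5 := by rw [Int.card_Icc]; ring_nf; rfl
      _ = _ := by simp
  · intro x hx hx01
    rw [Metric.mem_thickening_iff] at hx
    obtain ⟨z, hz, hxz⟩ := hx
    have hzy : dist z y < r := by
      have : edist z y < ENNReal.ofReal r := (Metric.edist_le_ediam_of_mem hz hy).trans_lt hdiam
      rwa [edist_lt_ofReal] at this
    have hxy : dist x y < 2 * r := by linarith [dist_triangle x z y]
    have hki : ∀ i, ((⌊x i / r⌋₊ : ℕ) : ℝ) ≤ x i / r ∧ x i / r < (⌊x i / r⌋₊ : ℕ) + 1 := fun i =>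
      ⟨Nat.floor_le (div_nonneg (hx01 i).1 hr0.le), Nat.lt_floor_add_one _⟩
    refine ⟨fun i => ⌊x i / r⌋₊, ?_, ?_⟩
    · rw [Fintype.mem_piFinset]
      intro i
      simp only [Finset.mem_filter, Finset.mem_range]
      constructor
      · have h1 : x i / r < 2 ^ j := by rw [div_lt_iff₀ hr0, h2r]; exact (hx01 i).2
        have : ((⌊x i / r⌋₊ : ℕ) : ℝ) < ((2 ^ j : ℕ) : ℝ) := by
          push_cast; linarith [(hki i).1]
        exact_mod_cast this
      · have h1 : |x i - y i| < 2 * r := by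
          have := dist_le_pi_dist x y i
          rw [Real.dist_eq] at this
          linarith
        rw [abs_lt] at h1
        have h2 : x i / r - y i / r < 2 := by rw [← sub_div, div_lt_iff₀ hr0]; exact h1.2
        have h3 : -2 < x i / r - y i / r := by rw [← sub_div, lt_div_iff₀ hr0]; linarith [h1.1]
        have h4 : (b i : ℝ) ≤ y i / r := Int.floor_le _
        have h5 : y i / r < b i + 1 := Int.lt_floor_add_one _
        have h6 := hki i
        have a1 : (((⌊x i / r⌋₊ : ℕ) : ℤ) : ℝ) - b i < 3 := by push_cast; linarith
        have a2 : -3 < (((⌊x i / r⌋₊ : ℕ) : ℤ) : ℝ) - b i := by push_cast; linarith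
        have a1' : ((⌊x i / r⌋₊ : ℕ) : ℤ) - b i < 3 := by exact_mod_cast a1
        have a2' : -3 < ((⌊x i / r⌋₊ : ℕ) : ℤ) - b i := by exact_mod_cast a2
        rw [abs_le]; constructor <;> omega
    · refine boxInd_of_mem ((mem_box _ _ _).2 fun i => ?_)
      have := hki i
      rw [le_div_iff₀ hr0, div_lt_iff₀ hr0] at this
      exact this

lemma choose_level (s : ℝ) (hs : 0 < s) (D : ENNReal) (hD : D ≤ ENNReal.ofReal (1 / 2)) (e : ℝ)
    (he : 0 < e) : ∃ j : ℕ, D < ENNReal.ofReal ((1 / 2) ^ j) ∧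
      (((2:ℝ) ^ s)⁻¹) ^ j ≤ 2 ^ s * (D.toReal) ^ s + e := by
  have h2s : (1:ℝ) < 2 ^ s := one_lt_rpow (by norm_num) hs
  rcases eq_or_ne D 0 with rfl | h0
  · have := tendsto_pow_atTop_nhds_zero_of_lt_one (r := ((2:ℝ) ^ s)⁻¹) (by positivity)
      (inv_lt_one_of_one_lt₀ h2s)
    obtain ⟨j, hj⟩ := (this.eventually_lt_const he).exists
    refine ⟨j, by simp, ?_⟩
    simp only [ENNReal.toReal_zero, zero_rpow hs.ne', mul_zero, zero_add]
    exact hj.le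
  · have htop : D ≠ ⊤ := ne_top_of_le_ne_top ENNReal.ofReal_ne_top hD
    set x := D.toReal with hx
    have hx0 : 0 < x := ENNReal.toReal_pos h0 htop
    have hDx : D = ENNReal.ofReal x := (ENNReal.ofReal_toReal htop).symm
    have hx1 : x ≤ 1 / 2 := by
      rw [hDx] at hD
      exact (ENNReal.ofReal_le_ofReal_iff (by norm_num)).1 hD
    obtain ⟨n, hn1, hn2⟩ := exists_nat_pow_near_of_lt_one (y := (1/2:ℝ)) hx0 (by linarith) (by norm_num) (by norm_num)
    rcases hn2.eq_or_lt with heq | hlt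
    · obtain ⟨m, rfl⟩ : ∃ m, n = m + 1 := ⟨n - 1, by
        rcases n with _ | n
        · simp at heq; linarith
        · rfl⟩
      refine ⟨m, ?_, ?_⟩
      · rw [hDx, ENNReal.ofReal_lt_ofReal_iff (by positivity), heq, pow_succ]
        have : (0:ℝ) < (1/2) ^ m := by positivity
        linarith
      · rw [heq]
        have : (2:ℝ) ^ s * ((1 / 2 : ℝ) ^ (m + 1)) ^ s = (((2:ℝ) ^ s)⁻¹) ^ m := by
          rw [← mul_rpow (by norm_num) (by positivity), pow_succ,
            show (2:ℝ) * ((1 / 2) ^ m * (1 / 2)) = (1 / 2) ^ m by ring, ← rpow_natCast,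
            ← rpow_mul (by norm_num), mul_comm, rpow_mul (by norm_num), rpow_natCast,
            one_div, inv_rpow (by norm_num)]
        rw [this]; linarith
    · refine ⟨n, ?_, ?_⟩
      · rw [hDx, ENNReal.ofReal_lt_ofReal_iff (by positivity)]; exact hlt
      · have : (((2:ℝ) ^ s)⁻¹) ^ n = (2:ℝ) ^ s * ((1 / 2 : ℝ) ^ (n + 1)) ^ s := by
          symm
          rw [← mul_rpow (by norm_num) (by positivity), pow_succ,
            show (2:ℝ) * ((1 / 2) ^ n * (1 / 2)) = (1 / 2) ^ n by ring, ← rpow_natCast,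
            ← rpow_mul (by norm_num), mul_comm, rpow_mul (by norm_num), rpow_natCast,
            one_div, inv_rpow (by norm_num)]
        rw [this]
        have : ((1 / 2 : ℝ) ^ (n + 1)) ^ s ≤ x ^ s := by gcongr
        have : (2:ℝ) ^ s * ((1 / 2 : ℝ) ^ (n + 1)) ^ s ≤ 2 ^ s * x ^ s := by gcongr
        linarith

end WA

namespace WA

lemma mass_bound {d : ℕ} {s c C1 : ℝ} {f : (Fin d → ℝ) → ℝ} (hc : 0 < c) (hf : Inv s c C1 f)
    (T : Finset ((_ : ℕ) × (Fin d → ℕ))) (hT : ∀ p ∈ T, p.2 ∈ idx d p.1)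
    (hcov : ∀ x, f x ≠ 0 → ∃ p ∈ T, cub p.1 p.2 x = 1) :
    c ^ 2 ≤ C1 * ∑ p ∈ T, (((2:ℝ) ^ s)⁻¹) ^ p.1 := by
  have h2s : (0:ℝ) < 2 ^ s := by positivity
  obtain ⟨C', hC', hE⟩ := hf.energy
  have hinteg : ∀ p ∈ T, Integrable (fun x => cub p.1 p.2 x * f x) := fun p hp =>
    boxFun_integrable (boxFun_mul (cub_mem p.2 (hT p hp)) hf.mem)
  have h1 : ∫ x, f x ≤ ∑ p ∈ T, ∫ x, cub p.1 p.2 x * f x := by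
    rw [← integral_finsetSum _ hinteg]
    refine integral_mono (boxFun_integrable hf.mem) (integrable_finsetSum _ hinteg) fun x => ?_
    simp only
    by_cases hx : f x = 0
    · simp [hx]
    · obtain ⟨p, hp, hpx⟩ := hcov x hx
      calc f x = cub p.1 p.2 x * f x := by rw [hpx, one_mul]
        _ ≤ _ := Finset.single_le_sum (f := fun p : (_ : ℕ) × (Fin d → ℕ) => cub p.1 p.2 x * f x)
          (fun p _ => mul_nonneg (cub_nonneg _ _) (hf.nonneg x)) hp
  have h2 := Finset.sum_sq_le_sum_mul_sum_of_sq_eq_mul T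
    (r := fun p => ∫ x, cub p.1 p.2 x * f x)
    (f := fun p => ((2:ℝ) ^ s) ^ p.1 * (∫ x, cub p.1 p.2 x * f x) ^ 2)
    (g := fun p => (((2:ℝ) ^ s)⁻¹) ^ p.1) (fun p _ => by positivity) (fun p _ => by positivity)
    (fun p _ => by
      rw [mul_right_comm, ← mul_pow, mul_inv_cancel₀ h2s.ne', one_pow, one_mul])
  have h3 : ∑ p ∈ T, ((2:ℝ) ^ s) ^ p.1 * (∫ x, cub p.1 p.2 x * f x) ^ 2 ≤ C1 := by
    obtain ⟨J, hJ⟩ : ∃ J, ∀ p ∈ T, p.1 < J :=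
      ⟨T.sup (fun p => p.1) + 1, fun p hp => Nat.lt_succ_of_le (Finset.le_sup (f := fun p => p.1) hp)⟩
    calc _ ≤ ∑ p ∈ (Finset.range J).sigma (fun j => idx d j),
          ((2:ℝ) ^ s) ^ p.1 * (∫ x, cub p.1 p.2 x * f x) ^ 2 := by
          refine Finset.sum_le_sum_of_subset_of_nonneg (fun p hp => ?_) fun p _ _ => by positivity
          rw [Finset.mem_sigma, Finset.mem_range]
          exact ⟨hJ p hp, hT p hp⟩
      _ = En s J f := by
          rw [Finset.sum_sigma]
          unfold En en
          refine Finset.sum_congr rfl fun j _ => ?_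
          rw [Finset.mul_sum]
      _ ≤ C1 := (hE J).trans hC'.le
  have h4 : 0 ≤ ∑ p ∈ T, (((2:ℝ) ^ s)⁻¹) ^ p.1 := Finset.sum_nonneg fun p _ => by positivity
  calc c ^ 2 ≤ (∑ p ∈ T, ∫ x, cub p.1 p.2 x * f x) ^ 2 :=
        pow_le_pow_left₀ hc.le (hf.mass.le.trans h1) 2
    _ ≤ _ := h2
    _ ≤ _ := mul_le_mul_of_nonneg_right h3 h4

lemma compact_cl {d : ℕ} {f : (Fin d → ℝ) → ℝ} (hf : f ∈ boxFun d) :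
    IsCompact (closure (Function.support f)) := by
  refine IsCompact.of_isClosed_subset (isCompact_Icc (a := (0 : Fin d → ℝ)) (b := 1)) isClosed_closure
    (closure_minimal (fun x hx => ?_) isClosed_Icc)
  have := boxFun_support hf x hx
  exact ⟨fun i => (this i).1, fun i => (this i).2.le⟩

lemma hausdorff_pos {d : ℕ} {s c C1 : ℝ} (hs : 0 < s) (hc : 0 < c) (f : ℕ → (Fin d → ℝ) → ℝ)
    (hf : ∀ n, Inv s c C1 (f n))
    (hanti : Antitone fun n => Function.support (f n)) :
    μH[s] (⋂ n, closure (Function.support (f n))) ≠ 0 := by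
  intro h0
  have h2s : (0:ℝ) < 2 ^ s := by positivity
  have hC1 : 0 ≤ C1 := by
    obtain ⟨C', hC', hE⟩ := (hf 0).energy
    have := hE 0
    simp [En] at this
    linarith
  set A : ℝ := C1 * (5 ^ d * (2 ^ s + 1)) with hA
  have hA0 : 0 ≤ A := by positivity
  obtain ⟨ε, hε, hεA⟩ : ∃ ε : ℝ, 0 < ε ∧ A * ε < c ^ 2 := by
    refine ⟨c ^ 2 / (A + 1), by positivity, ?_⟩
    rw [mul_div_assoc', div_lt_iff₀ (by positivity)]
    nlinarith [sq_pos_of_pos hc]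
  set K := ⋂ n, closure (Function.support (f n)) with hK
  rw [Measure.hausdorffMeasure_apply] at h0
  have h1 : (⨅ (t : ℕ → Set (Fin d → ℝ)) (_ : K ⊆ ⋃ n, t n)
      (_ : ∀ n, Metric.ediam (t n) ≤ ENNReal.ofReal (1 / 2)),
          ∑' n, ⨆ _ : (t n).Nonempty, Metric.ediam (t n) ^ s) < ENNReal.ofReal ε := by
    refine lt_of_le_of_lt ?_ (ENNReal.ofReal_pos.2 hε)
    rw [← h0]
    exact le_iSup₂_of_le (ENNReal.ofReal (1 / 2)) (ENNReal.ofReal_pos.2 (by norm_num)) le_rfl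
  simp only [iInf_lt_iff] at h1
  obtain ⟨t, htK, htd, hts⟩ := h1
  have hsum : ∑' n, Metric.ediam (t n) ^ s < ENNReal.ofReal ε := by
    refine lt_of_le_of_lt (ENNReal.tsum_le_tsum fun n => ?_) hts
    rcases (t n).eq_empty_or_nonempty with h | h
    · rw [h, Metric.ediam_empty, ENNReal.zero_rpow_of_pos hs]; exact zero_le
    · exact le_iSup_of_le h le_rfl
  choose j hj1 hj2 using fun n => choose_level s hs (Metric.ediam (t n)) (htd n) (ε * (1 / 2) ^ (n + 1))
    (by positivity)
  choose T hT1 hT2 hT3 using fun n => small_cover (t n) (j n) (hj1 n)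
  set U : ℕ → Set (Fin d → ℝ) := fun n => Metric.thickening ((1 / 2) ^ (j n)) (t n) with hU
  have hUo : ∀ n, IsOpen (U n) := fun n => Metric.isOpen_thickening
  have hKU : K ⊆ ⋃ n, U n := htK.trans
    (iUnion_mono fun n => Metric.self_subset_thickening (by positivity) _)
  obtain ⟨m, hm⟩ := exists_subset_nhds_of_isCompact
    (V := fun n => closure (Function.support (f n))) (U := ⋃ n, U n)
    (Antitone.directed_ge fun a b hab => closure_mono (hanti hab))
    (fun n => compact_cl (hf n).mem)
    (fun x hx => (isOpen_iUnion hUo).mem_nhds (hKU hx))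
  obtain ⟨F, hF⟩ := (compact_cl (hf m).mem).elim_finite_subcover U hUo hm
  classical
  set S : Finset ((_ : ℕ) × (Fin d → ℕ)) := F.biUnion fun n =>
    (T n).image (fun k => (⟨j n, k⟩ : (_ : ℕ) × (Fin d → ℕ))) with hS
  have hb := mass_bound hc (hf m) S ?_ ?_
  · have h3 : ∑ p ∈ S, (((2:ℝ) ^ s)⁻¹) ^ p.1 ≤ (5 ^ d * (2 ^ s + 1)) * ε := by
      calc _ ≤ ∑ n ∈ F, ∑ p ∈ (T n).image (fun k => (⟨j n, k⟩ : (_ : ℕ) × (Fin d → ℕ))),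
            (((2:ℝ) ^ s)⁻¹) ^ p.1 := sum_biUnion_le' _ _ _ fun p => by positivity
        _ ≤ ∑ n ∈ F, 5 ^ d * (2 ^ s * (Metric.ediam (t n) ^ s).toReal + ε * (1 / 2) ^ (n + 1)) := by
            refine Finset.sum_le_sum fun n _ => ?_
            have e1 : ∀ p ∈ (T n).image (fun k => (⟨j n, k⟩ : (_ : ℕ) × (Fin d → ℕ))),
              (((2:ℝ) ^ s)⁻¹) ^ p.1 = (((2:ℝ) ^ s)⁻¹) ^ (j n) := by
              intro p hp
              rw [Finset.mem_image] at hp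
              obtain ⟨k, _, rfl⟩ := hp
              rfl
            rw [Finset.sum_congr rfl e1, Finset.sum_const, nsmul_eq_mul]
            have e2 : ((((T n).image (fun k => (⟨j n, k⟩ : (_ : ℕ) × (Fin d → ℕ)))).card : ℕ) : ℝ)
                ≤ 5 ^ d := by
              exact_mod_cast Finset.card_image_le.trans (hT2 n)
            have e3 := hj2 n
            rw [ENNReal.toReal_rpow] at e3
            gcongr
        _ = 5 ^ d * (2 ^ s * ∑ n ∈ F, (Metric.ediam (t n) ^ s).toReal +
              ε * ∑ n ∈ F, (1 / 2 : ℝ) ^ (n + 1)) := by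
            rw [← Finset.mul_sum, Finset.sum_add_distrib, ← Finset.mul_sum, ← Finset.mul_sum]
        _ ≤ 5 ^ d * (2 ^ s * ε + ε * 1) := by
            have e1 : ∑ n ∈ F, (Metric.ediam (t n) ^ s).toReal ≤ ε := by
              rw [← ENNReal.toReal_sum]
              · refine ENNReal.toReal_le_of_le_ofReal hε.le ((ENNReal.sum_le_tsum F).trans hsum.le)
              · intro n _
                exact ENNReal.rpow_ne_top_of_nonneg hs.le
                  (ne_top_of_le_ne_top ENNReal.ofReal_ne_top (htd n))
            have e2 : ∑ n ∈ F, (1 / 2 : ℝ) ^ (n + 1) ≤ 1 := by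
              have hs1 : Summable fun n : ℕ => (1 / 2 : ℝ) ^ (n + 1) := by
                simp only [pow_succ]
                exact summable_geometric_two.mul_right _
              refine (hs1.sum_le_tsum F fun n _ => by positivity).trans (le_of_eq ?_)
              simp only [pow_succ]
              rw [tsum_mul_right, tsum_geometric_two]; norm_num
            gcongr
        _ = _ := by ring
    have : C1 * ∑ p ∈ S, (((2:ℝ) ^ s)⁻¹) ^ p.1 ≤ A * ε := by
      rw [hA, mul_assoc]; gcongr
    linarith
  · intro p hp
    simp only [hS, Finset.mem_biUnion, Finset.mem_image] at hp
    obtain ⟨n, _, k, hk, rfl⟩ := hp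
    exact hT1 n hk
  · intro x hx
    have := hF (subset_closure hx)
    simp only [mem_iUnion] at this
    obtain ⟨n, hn, hxn⟩ := this
    obtain ⟨k, hk, hkx⟩ := hT3 n x hxn (boxFun_support (hf m).mem x hx)
    refine ⟨⟨j n, k⟩, ?_, hkx⟩
    simp only [hS, Finset.mem_biUnion, Finset.mem_image]
    exact ⟨n, hn, k, hk, rfl⟩

end WA

namespace WA

lemma start_inv (d : ℕ) (s : ℝ) (hsd : s < d) :
    ∃ c C1 : ℝ, 0 < c ∧ Inv s c C1 (boxInd (fun _ : Fin d => (0:ℝ)) (fun _ => 1 / 2)) := by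
  set f0 : (Fin d → ℝ) → ℝ := boxInd (fun _ : Fin d => (0:ℝ)) (fun _ => 1 / 2) with hf0
  have hmem : f0 ∈ boxFun d := boxInd_mem _ _ (fun i => by norm_num) (fun i => by norm_num)
  set θ : ℝ := (2:ℝ) ^ s * ((2:ℝ) ^ d)⁻¹ with hθ
  have h2s : (0:ℝ) < 2 ^ s := by positivity
  have hθ0 : 0 ≤ θ := by positivity
  have hθ1 : θ < 1 := by
    rw [hθ, ← div_eq_mul_inv, div_lt_one (by positivity), ← rpow_natCast]
    exact rpow_lt_rpow_of_exponent_lt (by norm_num) hsd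
  have hinteg : ∫ x, f0 x = (1 / 2 : ℝ) ^ d := by
    rw [hf0, integral_boxInd]
    simp
  refine ⟨(1 / 2 : ℝ) ^ d / 2, (1 - θ)⁻¹ + 1, by positivity, hmem, boxInd_nonneg _ _, ?_,
    (1 - θ)⁻¹, by linarith, fun J => ?_⟩
  · rw [hinteg]
    have : (0:ℝ) < (1 / 2 : ℝ) ^ d := by positivity
    linarith
  · have hen : ∀ j, en f0 j ≤ (((2:ℝ) ^ d)⁻¹) ^ j := by
      intro j
      unfold en
      have h1 : ∀ k ∈ idx d j, (∫ x, cub j k x * f0 x) ^ 2 ≤ (((1 / 2 : ℝ) ^ j) ^ d) ^ 2 := by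
        intro k hk
        refine pow_le_pow_left₀ (cub_int_nonneg k (boxInd_nonneg _ _)) ?_ 2
        calc ∫ x, cub j k x * f0 x ≤ ∫ x, cub j k x := by
              refine integral_mono (boxFun_integrable (boxFun_mul (cub_mem k hk) hmem))
                (boxFun_integrable (cub_mem k hk)) fun x => ?_
              have h1 := cub_nonneg (j := j) k x
              have h2 : f0 x ≤ 1 := boxInd_le_one _ _ x
              change cub j k x * f0 x ≤ cub j k x
              nlinarith
          _ = _ := by
              unfold cub
              rw [integral_boxInd]
              have : ∀ i : Fin d, max (((k i : ℝ) + 1) * (1 / 2) ^ j - (k i : ℝ) * (1 / 2) ^ j) 0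
                  = (1 / 2 : ℝ) ^ j := fun i => by
                rw [show ((k i : ℝ) + 1) * (1 / 2) ^ j - (k i : ℝ) * (1 / 2) ^ j = (1 / 2 : ℝ) ^ j by ring]
                exact max_eq_left (by positivity)
              simp only [this, Finset.prod_const, Finset.card_univ, Fintype.card_fin]
      refine (Finset.sum_le_sum h1).trans (le_of_eq ?_)
      rw [Finset.sum_const, idx, Fintype.card_piFinset, nsmul_eq_mul]
      simp only [Finset.card_range, Finset.prod_const, Finset.card_univ, Fintype.card_fin]
      push_cast
      have e1 : ((2:ℝ) ^ j) ^ d * ((1 / 2 : ℝ) ^ j) ^ d = 1 := by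
        rw [← mul_pow, ← mul_pow]; norm_num
      rw [sq, ← mul_assoc, e1, one_mul, ← pow_mul, inv_pow, ← pow_mul, mul_comm j d]
      simp
    have := tail_sum (fun j => ((2:ℝ) ^ s) ^ j * en f0 j)
      (fun j => mul_nonneg (by positivity) (en_nonneg _ _)) 1 θ zero_le_one hθ0 hθ1 (fun j => ?_) 0 J
    · simpa [En] using this
    · rw [hθ, mul_pow, one_mul]
      gcongr
      exact hen j

lemma good_gN {d : ℕ} (t : Fin d → ℝ) (ht : ∀ i, 0 < t i) (s0 : ℝ) (hs0 : 0 ≤ s0) (hsd : s0 ≤ d)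
    (htsum : 1 < ∑ i, t i)
    (hk : ∀ k, s0 * (1 + t k) ≤ d + 1 + ∑ i, max (t k - t i) 0)
    (ε : ℝ) (hε : 0 < ε) (hε1 : ε < 1) : ∃ C, Good (s0 - ε) (gN t) C := by
  obtain ⟨C, hC, h⟩ := energy t ht s0 hs0 hsd htsum hk ε hε hε1
  refine ⟨C, fun N hN => gN_mem t ht N hN, fun N hN => gN_nonneg t N hN, fun f hf => gN_tendsto t ht hf,
    fun N hN j => ?_, hC⟩
  have h1 := h N hN (2 ^ j) ((1 / 2) ^ j) (by positivity) (pow_le_one₀ (by norm_num) (by norm_num))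
  have h2 : ((1 / 2 : ℝ) ^ j) ^ (s0 - ε) = (((2:ℝ) ^ (s0 - ε))⁻¹) ^ j := by
    rw [← rpow_natCast, ← rpow_mul (by norm_num), mul_comm, rpow_mul (by norm_num), rpow_natCast,
      one_div, inv_rpow (by norm_num)]
  rw [h2] at h1
  refine le_trans (le_of_eq ?_) h1
  unfold en idx
  refine Finset.sum_congr rfl fun k _ => ?_
  unfold cub
  rw [integral_boxInd_gN]

lemma lower {d : ℕ} (t : Fin d → ℝ) (ht : ∀ i, 0 < t i) (s0 : ℝ) (hsd : s0 ≤ d)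
    (htsum : 1 < ∑ i, t i)
    (hk : ∀ k, s0 * (1 + t k) ≤ d + 1 + ∑ i, max (t k - t i) 0)
    (s : ℝ) (hs : 0 < s) (hss : s < s0) :
    ∃ K : Set (Fin d → ℝ), μH[s] K ≠ 0 ∧ ∀ x ∈ K, (∀ i, x i ∈ Ico (0:ℝ) 1) ∧
      ∀ n : ℕ, ∃ q : ℕ, n < q ∧ ∃ p : Fin d → ℤ, ∀ i, |(q:ℝ) * x i - p i| < (q:ℝ) ^ (-(t i)) := by
  obtain ⟨c, C1, hc, h0⟩ := start_inv d s (hss.trans_le hsd)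
  set ε := min ((s0 - s) / 2) (1 / 2) with hε
  have hε0 : 0 < ε := lt_min (by linarith) (by norm_num)
  have hε1 : ε < 1 := (min_le_right _ _).trans_lt (by norm_num)
  have hε2 : ε ≤ (s0 - s) / 2 := min_le_left _ _
  obtain ⟨C, hg⟩ := good_gN t ht s0 (by linarith) hsd htsum hk ε hε0 hε1
  obtain ⟨f, hf0, hf, hstep⟩ := construct (s := s) (by linarith) hg h0
  have hanti : Antitone fun n => Function.support (f n) := by
    refine antitone_nat_of_succ_le fun n => ?_
    obtain ⟨N, _, _, hN⟩ := hstep n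
    rw [hN]
    intro x hx
    simp only [Function.mem_support, Pi.mul_apply] at hx ⊢
    exact left_ne_zero_of_mul hx
  refine ⟨⋂ n, closure (Function.support (f n)), hausdorff_pos hs hc f hf hanti, fun x hx => ?_⟩
  rw [mem_iInter] at hx
  constructor
  · have h1 : x ∈ Icc (fun _ : Fin d => (0:ℝ)) (fun _ => 1 / 2) := by
      refine closure_minimal (fun y hy => ?_) isClosed_Icc (hx 0)
      rw [hf0] at hy
      have := (mem_box _ _ _).1 (mem_of_boxInd hy)
      exact ⟨fun i => (this i).1, fun i => (this i).2.le⟩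
    intro i
    have h2 := h1.1 i
    have h3 := h1.2 i
    simp only at h2 h3
    exact ⟨h2, by linarith⟩
  · intro n
    obtain ⟨N, hnN, hN1, hN⟩ := hstep n
    have h1 : x ∈ closure (Function.support (gN t N)) := by
      refine closure_mono ?_ (hx (n + 1))
      rw [hN]
      intro x hx
      simp only [Function.mem_support, Pi.mul_apply] at hx ⊢
      exact right_ne_zero_of_mul hx
    obtain ⟨q, hq, p, hp⟩ := gN_closure t N x h1
    rw [Finset.mem_Ioc] at hq
    refine ⟨q, by omega, fun i => (p i : ℤ), fun i => ?_⟩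
    have hq0 : (0:ℝ) < q := by exact_mod_cast (by omega : 0 < q)
    set X : ℝ := ((2 * N : ℕ) : ℝ) with hX
    have hqX : (q:ℝ) ≤ X := by rw [hX]; exact_mod_cast hq.2
    have hX0 : 0 < X := hq0.trans_le hqX
    have e1 := (hp i).1
    have e2 := (hp i).2
    have e3 : (p i : ℝ) / q * q = p i := div_mul_cancel₀ _ hq0.ne'
    have e4 : 0 ≤ (q:ℝ) * x i - p i := by nlinarith
    have e5 : (q:ℝ) * x i - p i ≤ q * rho t N i := by nlinarith
    have e6 : (q:ℝ) * rho t N i ≤ X ^ (-(t i)) / 2 := by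
      unfold rho
      rw [← hX]
      have : X ^ (-(t i)) = X * X ^ (-(1 + t i)) := by
        rw [← rpow_one_add' hX0.le (by linarith [ht i])]; congr 1; ring
      rw [this]
      have := rpow_pos_of_pos hX0 (-(1 + t i))
      nlinarith
    have e7 : X ^ (-(t i)) ≤ (q:ℝ) ^ (-(t i)) :=
      rpow_le_rpow_of_nonpos hq0 hqX (by linarith [ht i])
    have e8 := rpow_pos_of_pos hX0 (-(t i))
    push_cast
    rw [abs_of_nonneg e4]
    linarith

end WA

namespace WA

/-- the limsup set in coordinates -/
def WW {d : ℕ} (t : Fin d → ℝ) : Set (Fin d → ℝ) :=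
  {x | (∀ i, x i ∈ Ico (0:ℝ) 1) ∧
      ∀ n : ℕ, ∃ q : ℕ, n < q ∧ ∃ p : Fin d → ℤ, ∀ i, |(q:ℝ) * x i - p i| < (q:ℝ) ^ (-(t i))}

lemma p_range (q : ℕ) (hq : 0 < q) (t x : ℝ) (ht : 0 < t) (p : ℤ) (hx : x ∈ Ico (0:ℝ) 1)
    (h : |(q:ℝ) * x - p| < (q:ℝ) ^ (-t)) : 0 ≤ p ∧ p ≤ q := by
  have hq1 : (1:ℝ) ≤ q := by exact_mod_cast hq
  have h1 : (q:ℝ) ^ (-t) ≤ 1 := rpow_le_one_of_one_le_of_nonpos hq1 (by linarith)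
  have h2 := abs_lt.1 (h.trans_le h1)
  have h3 : (0:ℝ) ≤ q * x := mul_nonneg (by positivity) hx.1
  have h4 : (q:ℝ) * x < q := by nlinarith [hx.2]
  constructor
  · have : (-1:ℝ) < p := by linarith
    have : (-1:ℤ) < p := by exact_mod_cast this
    omega
  · have : (p:ℝ) < q + 1 := by linarith
    have : p < q + 1 := by exact_mod_cast this
    omega

/-- centre of a covering ball -/
noncomputable def ctr {d : ℕ} (t : Fin d → ℝ) (k : Fin d) (q : ℕ) (p m : Fin d → ℕ) : Fin d → ℝ :=
  fun i => (p i : ℝ) / q - (q:ℝ) ^ (-(1 + t i)) + m i * (q:ℝ) ^ (-(1 + t k))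

/-- number of pieces -/
noncomputable def Mn {d : ℕ} (t : Fin d → ℝ) (k : Fin d) (q : ℕ) (i : Fin d) : ℕ :=
  ⌊2 * (q:ℝ) ^ (max (t k - t i) 0)⌋₊ + 1

lemma cover_pt {d : ℕ} (t : Fin d → ℝ) (ht : ∀ i, 0 < t i) (k : Fin d) (q : ℕ) (hq : 0 < q)
    (x : Fin d → ℝ) (hx : ∀ i, x i ∈ Ico (0:ℝ) 1) (p : Fin d → ℤ)
    (hp : ∀ i, |(q:ℝ) * x i - p i| < (q:ℝ) ^ (-(t i))) :
    ∃ P m : Fin d → ℕ, (∀ i, P i < q + 1) ∧ (∀ i, m i < Mn t k q i) ∧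
      x ∈ Metric.closedBall (ctr t k q P m) ((q:ℝ) ^ (-(1 + t k))) := by
  have hq0 : (0:ℝ) < q := by exact_mod_cast hq
  have hq1 : (1:ℝ) ≤ q := by exact_mod_cast hq
  set δ := (q:ℝ) ^ (-(1 + t k)) with hδ
  have hδ0 : 0 < δ := rpow_pos_of_pos hq0 _
  have hp0 := fun i => p_range q hq (t i) (x i) (ht i) (p i) (hx i) (hp i)
  set y : Fin d → ℝ := fun i => x i - (p i : ℝ) / q + (q:ℝ) ^ (-(1 + t i)) with hy
  have hy' : ∀ i, 0 ≤ y i ∧ y i < 2 * (q:ℝ) ^ (-(1 + t i)) := by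
    intro i
    have e1 : (q:ℝ) ^ (-(t i)) = q * (q:ℝ) ^ (-(1 + t i)) := by
      rw [← rpow_one_add' hq0.le (by linarith [ht i])]; congr 1; ring
    have h := abs_lt.1 (hp i)
    rw [e1] at h
    have e3 : (p i : ℝ) = (p i : ℝ) / q * q := (div_mul_cancel₀ _ hq0.ne').symm
    rw [e3] at h
    simp only [hy]
    set u := (q:ℝ) ^ (-(1 + t i))
    set v := (p i : ℝ) / q
    constructor
    · have : 0 < q * (x i - v + u) := by linarith [h.1]
      exact (pos_of_mul_pos_right this hq0.le).le
    · have : q * (x i - v) < q * u := by linarith [h.2]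
      have := lt_of_mul_lt_mul_left this hq0.le
      linarith
  refine ⟨fun i => (p i).toNat, fun i => ⌊y i / δ⌋₊, fun i => ?_, fun i => ?_, ?_⟩
  · have := hp0 i
    simp only
    omega
  · unfold Mn
    refine Nat.lt_succ_of_le (Nat.floor_le_floor ?_)
    rw [div_le_iff₀ hδ0]
    refine (hy' i).2.le.trans ?_
    rw [mul_assoc, hδ, ← rpow_add hq0]
    have := le_max_left (t k - t i) 0
    have h9 : -(1 + t i) ≤ max (t k - t i) 0 + -(1 + t k) := by linarith
    have := rpow_le_rpow_of_exponent_le hq1 h9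
    linarith
  · rw [Metric.mem_closedBall, dist_pi_le_iff hδ0.le]
    intro i
    have e1 : (((p i).toNat : ℕ) : ℝ) = (p i : ℝ) := by
      have : (((p i).toNat : ℕ) : ℤ) = p i := Int.toNat_of_nonneg (hp0 i).1
      exact_mod_cast congrArg (fun z : ℤ => (z : ℝ)) this
    rw [Real.dist_eq]
    have e2 : x i - ctr t k q (fun i => (p i).toNat) (fun i => ⌊y i / δ⌋₊) i
        = y i - ⌊y i / δ⌋₊ * δ := by
      simp only [ctr, hy, e1, ← hδ]; ring
    rw [e2]
    have e3 := Nat.floor_le (div_nonneg (hy' i).1 hδ0.le)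
    have e4 := Nat.lt_floor_add_one (y i / δ)
    rw [le_div_iff₀ hδ0] at e3
    rw [div_lt_iff₀ hδ0] at e4
    rw [abs_le]; constructor <;> linarith

/-- index type for the covering -/
def Ix {d : ℕ} (t : Fin d → ℝ) (k : Fin d) (q : ℕ) : Type :=
  ∀ i : Fin d, Fin (q + 1) × Fin (Mn t k q i)

noncomputable instance {d : ℕ} (t : Fin d → ℝ) (k : Fin d) (q : ℕ) : Fintype (Ix t k q) := by
  unfold Ix; infer_instance

lemma card_Ix {d : ℕ} (t : Fin d → ℝ) (k : Fin d) (q : ℕ) (hq : 0 < q) :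
    (Fintype.card (Ix t k q) : ℝ) ≤ 6 ^ d * (q:ℝ) ^ ((d:ℝ) + ∑ i, max (t k - t i) 0) := by
  have hq0 : (0:ℝ) < q := by exact_mod_cast hq
  have hq1 : (1:ℝ) ≤ q := by exact_mod_cast hq
  have h1 : Fintype.card (Ix t k q) = ∏ i, ((q + 1) * Mn t k q i) := by
    have : Fintype.card (∀ i : Fin d, Fin (q + 1) × Fin (Mn t k q i)) = _ := Fintype.card_pi
    simp only [Fintype.card_prod, Fintype.card_fin] at this
    rw [← this]
    exact Fintype.card_congr (Equiv.refl _)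
  rw [h1]
  push_cast
  have h2 : (6:ℝ) ^ d * (q:ℝ) ^ ((d:ℝ) + ∑ i, max (t k - t i) 0)
      = ∏ i : Fin d, (6 * q * (q:ℝ) ^ (max (t k - t i) 0)) := by
    rw [Finset.prod_mul_distrib, ← rpow_sum_of_pos hq0, rpow_add hq0, rpow_natCast]
    simp [mul_pow, mul_assoc]
  rw [h2]
  refine Finset.prod_le_prod (fun i _ => by positivity) fun i _ => ?_
  have e1 : (1:ℝ) ≤ (q:ℝ) ^ (max (t k - t i) 0) := one_le_rpow hq1 (le_max_right _ _)
  have e2 : (Mn t k q i : ℝ) ≤ 3 * (q:ℝ) ^ (max (t k - t i) 0) := by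
    unfold Mn
    push_cast
    have := Nat.floor_le (show 0 ≤ 2 * (q:ℝ) ^ (max (t k - t i) 0) by positivity)
    linarith
  calc ((q:ℝ) + 1) * (Mn t k q i) ≤ (2 * q) * (3 * (q:ℝ) ^ (max (t k - t i) 0)) := by
        gcongr; linarith
    _ = _ := by ring

lemma upper {d : ℕ} (t : Fin d → ℝ) (ht : ∀ i, 0 < t i) (k : Fin d) (s : ℝ) (hs : 0 ≤ s)
    (hsk : d + 1 + ∑ i, max (t k - t i) 0 < s * (1 + t k)) : μH[s] (WW t) = 0 := by
  set e : ℝ := (d:ℝ) + ∑ i, max (t k - t i) 0 - s * (1 + t k) with he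
  have he1 : e < -1 := by linarith
  set F : ℕ → ENNReal := fun q => ENNReal.ofReal (6 ^ d * 2 ^ s * ((q + 1 : ℕ) : ℝ) ^ e) with hF
  have hFsum : ∑' q, F q ≠ ⊤ := by
    refine Summable.tsum_ofReal_ne_top ?_
    have h1 := (Real.summable_nat_rpow.2 he1)
    have h2 := (summable_nat_add_iff 1).2 h1
    exact h2.mul_left _
  have htail := ENNReal.tendsto_sum_nat_add F hFsum
  have hball : ∀ q : ℕ, 0 < q → ∀ c : Fin d → ℝ,
      Metric.ediam (Metric.closedBall c ((q:ℝ) ^ (-(1 + t k)))) ≤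
        ENNReal.ofReal (2 * (q:ℝ) ^ (-(1 + t k))) := by
    intro q hq c
    have h1 : (0:ℝ) ≤ (q:ℝ) ^ (-(1 + t k)) := by positivity
    refine Metric.ediam_le fun x hx y hy => ?_
    rw [edist_dist]
    refine ENNReal.ofReal_le_ofReal ?_
    have := dist_triangle_right x y c
    rw [Metric.mem_closedBall] at hx hy
    linarith
  have key := Measure.hausdorffMeasure_le_liminf_tsum (X := Fin d → ℝ) (β := ℕ)
    (ι := fun N => (n : ℕ) × Ix t k (n + N + 1)) s (WW t) (l := Filter.atTop)
    (fun N => ENNReal.ofReal (2 * (1 / ((N:ℝ) + 1)))) ?_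
    (fun N z => Metric.closedBall (ctr t k (z.1 + N + 1) (fun i => (z.2 i).1) (fun i => (z.2 i).2))
      (((z.1 + N + 1 : ℕ) : ℝ) ^ (-(1 + t k)))) ?_ ?_
  · refine le_antisymm (key.trans ?_) zero_le
    rw [← htail.liminf_eq]
    refine Filter.liminf_le_liminf (Filter.Eventually.of_forall fun N => ?_)
    rw [ENNReal.tsum_sigma']
    refine ENNReal.tsum_le_tsum fun n => ?_
    rw [tsum_fintype]
    have hq : 0 < n + N + 1 := by omega
    have hq0 : (0:ℝ) < ((n + N + 1 : ℕ) : ℝ) := by exact_mod_cast hq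
    calc _ ≤ ∑ z : Ix t k (n + N + 1),
          (ENNReal.ofReal (2 * ((n + N + 1 : ℕ) : ℝ) ^ (-(1 + t k)))) ^ s := by
          refine Finset.sum_le_sum fun z _ => ENNReal.rpow_le_rpow (hball _ hq _) hs
      _ = ENNReal.ofReal ((Fintype.card (Ix t k (n + N + 1)) : ℝ) *
            (2 * ((n + N + 1 : ℕ) : ℝ) ^ (-(1 + t k))) ^ s) := by
          rw [Finset.sum_const, nsmul_eq_mul, ENNReal.ofReal_mul (Nat.cast_nonneg (Fintype.card (Ix t k (n + N + 1)))),
            ENNReal.ofReal_natCast, ENNReal.ofReal_rpow_of_nonneg (by positivity) hs]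
          rfl
      _ ≤ _ := by
          refine ENNReal.ofReal_le_ofReal ?_
          have h1 := card_Ix t k (n + N + 1) hq
          calc _ ≤ (6 ^ d * ((n + N + 1 : ℕ) : ℝ) ^ ((d:ℝ) + ∑ i, max (t k - t i) 0)) *
                (2 * ((n + N + 1 : ℕ) : ℝ) ^ (-(1 + t k))) ^ s := by gcongr
            _ = _ := by
              rw [mul_rpow (by norm_num) (by positivity), ← rpow_mul hq0.le, he]
              rw [show (d:ℝ) + ∑ i, max (t k - t i) 0 - s * (1 + t k) =
                (d:ℝ) + ∑ i, max (t k - t i) 0 + (-(1 + t k) * s) by ring, rpow_add hq0 _ (-(1 + t k) * s)]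
              ring
  · have := (tendsto_one_div_add_atTop_nhds_zero_nat (𝕜 := ℝ)).const_mul 2
    rw [mul_zero] at this
    simpa using ENNReal.tendsto_ofReal this
  · refine Filter.Eventually.of_forall fun N z => (hball _ (by omega) _).trans (ENNReal.ofReal_le_ofReal ?_)
    have h1 : (1:ℝ) ≤ ((z.1 + N + 1 : ℕ) : ℝ) := by exact_mod_cast (by omega : 1 ≤ z.1 + N + 1)
    gcongr
    calc ((z.1 + N + 1 : ℕ) : ℝ) ^ (-(1 + t k)) ≤ ((z.1 + N + 1 : ℕ) : ℝ) ^ (-1 : ℝ) :=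
          rpow_le_rpow_of_exponent_le h1 (by linarith [ht k])
      _ ≤ _ := by
          rw [rpow_neg_one, ← one_div]
          push_cast
          gcongr
          have : (0:ℝ) ≤ z.1 := by positivity
          linarith
  · refine Filter.Eventually.of_forall fun N x hx => ?_
    obtain ⟨hx01, hx⟩ := hx
    obtain ⟨q, hq, p, hp⟩ := hx N
    obtain ⟨n, rfl⟩ : ∃ n, q = n + N + 1 := ⟨q - N - 1, by omega⟩
    obtain ⟨P, m, hP, hm, hball⟩ := cover_pt t ht k (n + N + 1) (by omega) x hx01 p hp
    rw [mem_iUnion]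
    exact ⟨⟨n, fun i => (⟨P i, hP i⟩, ⟨m i, hm i⟩)⟩, hball⟩

end WA

namespace WA

lemma wNorm_lt {d : ℕ} [Nonempty (Fin d)] (w : Fin d → ℝ) (hw : ∀ i, 0 < w i) (τ : ℝ) (q : ℕ) (hq : 0 < q)
    (y : Fin d → ℝ) : wNorm w y < 1 * (q:ℝ) ^ (-τ) ↔ ∀ i, |y i| < (q:ℝ) ^ (-(τ * w i)) := by
  have hq0 : (0:ℝ) < q := by exact_mod_cast hq
  have h1 : ∀ i, |y i| ^ (1 / w i) < (q:ℝ) ^ (-τ) ↔ |y i| < (q:ℝ) ^ (-(τ * w i)) := by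
    intro i
    rw [one_div, rpow_inv_lt_iff_of_pos (abs_nonneg _) (by positivity) (hw i), ← rpow_mul hq0.le,
      neg_mul]
  unfold wNorm
  rw [one_mul]
  constructor
  · intro h i
    rw [← h1]
    exact (le_ciSup (f := fun i => |y i| ^ (1 / w i)) (Set.finite_range _).bddAbove i).trans_lt h
  · intro h
    obtain ⟨i, hi⟩ := exists_eq_ciSup_of_finite (f := fun i => |y i| ^ (1 / w i))
    rw [← hi]
    exact (h1 i).2 (h i)

lemma wApprox_eq {d : ℕ} [Nonempty (Fin d)] (w : Fin d → ℝ) (hw : ∀ i, 0 < w i) (τ : ℝ) (hτ : 0 < τ) :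
    wApprox w 1 τ = WW (fun i => τ * w i) := by
  ext x
  unfold wApprox WW
  simp only [Set.mem_ofPred_eq]
  refine and_congr_right fun hx => ?_
  constructor
  · intro hinf n
    by_contra hcon
    push Not at hcon
    refine hinf (Set.Finite.subset ((Set.Finite.pi' (fun _ : Fin d => Set.finite_Icc (0:ℤ) n)).prod
      (Set.finite_Iic n)) ?_)
    rintro ⟨p, q⟩ ⟨hq, hpq⟩
    simp only at hq hpq
    rw [wNorm_lt w hw τ q hq] at hpq
    have hqn : q ≤ n := by
      by_contra hlt
      obtain ⟨i, hi⟩ := hcon q (by omega) p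
      exact absurd (hpq i) (not_lt.2 hi)
    refine ⟨fun i => ?_, hqn⟩
    have := p_range q hq (τ * w i) (x i) (mul_pos hτ (hw i)) (p i) (hx i) (hpq i)
    have h2 : (q:ℤ) ≤ n := by exact_mod_cast hqn
    exact ⟨this.1, this.2.trans h2⟩
  · intro h hfin
    obtain ⟨n, hn⟩ := (hfin.image Prod.snd).bddAbove
    obtain ⟨q, hq, p, hp⟩ := h n
    have : q ≤ n := hn ⟨(p, q), ⟨by simp only; omega, by
      simp only
      rw [wNorm_lt w hw τ q (by omega)]
      exact hp⟩, rfl⟩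
    omega

end WA

theorem dimH_approx (d : ℕ) (hd : 1 ≤ d) (w : Fin d → ℝ)
    (hw0 : ∀ i, 0 < w i) (hw1 : ∀ i, w i < 1) (hwmono : Monotone w)
    (hwsum : ∑ i, w i = 1) (τ : ℝ) (hτ : 1 < τ) :
    dimH (wApprox w 1 τ) =
      ENNReal.ofReal (⨅ k : Fin d,
        ((d : ℝ) + 1 + ∑ i : Fin d, if i ≤ k then τ * w k - τ * w i else 0) /
          (1 + τ * w k)) := by
  haveI : Nonempty (Fin d) := ⟨⟨0, by omega⟩⟩
  have hτ0 : 0 < τ := by linarith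
  set t : Fin d → ℝ := fun i => τ * w i with ht
  have ht0 : ∀ i, 0 < t i := fun i => mul_pos hτ0 (hw0 i)
  have hmax : ∀ k i : Fin d, (if i ≤ k then τ * w k - τ * w i else 0) = max (t k - t i) 0 := by
    intro k i
    simp only [ht]
    split_ifs with h
    · rw [max_eq_left]
      have := mul_le_mul_of_nonneg_left (hwmono h) hτ0.le
      linarith
    · rw [max_eq_right]
      have := mul_le_mul_of_nonneg_left (hwmono (not_le.1 h).le) hτ0.le
      linarith
  simp only [hmax]
  set S : Fin d → ℝ := fun k => ((d : ℝ) + 1 + ∑ i : Fin d, max (t k - t i) 0) / (1 + t k) with hS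
  change _ = ENNReal.ofReal (⨅ k, S k)
  have hden : ∀ k, 0 < 1 + t k := fun k => by linarith [ht0 k]
  have hsumt : ∑ i, t i = τ := by
    simp only [ht]
    rw [← Finset.mul_sum, hwsum, mul_one]
  have hle : ∀ k, (⨅ k, S k) ≤ S k := fun k => ciInf_le (Set.finite_range _).bddBelow k
  have hW := WA.wApprox_eq w hw0 τ hτ0
  rw [hW]
  refine le_antisymm ?_ ?_
  · obtain ⟨k, hk⟩ := exists_eq_ciInf_of_finite (f := S)
    rw [← hk]
    by_contra hcon
    rw [not_le] at hcon
    obtain ⟨r, hr1, hr2⟩ := ENNReal.lt_iff_exists_nnreal_btwn.1 hcon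
    have hSr : S k < r := by
      by_contra h
      rw [not_lt] at h
      have := ENNReal.ofReal_le_ofReal h
      rw [ENNReal.ofReal_coe_nnreal] at this
      exact absurd hr1 (not_lt.2 this)
    have h0 := WA.upper t ht0 k r r.2 (by
      simp only [hS] at hSr
      rwa [div_lt_iff₀ (hden k)] at hSr)
    have := dimH_le_of_hausdorffMeasure_ne_top (s := WA.WW t) (d := r) (by rw [h0]; exact ENNReal.zero_ne_top)
    exact absurd hr2 (not_lt.2 this)
  · by_contra hcon
    rw [not_le] at hcon
    obtain ⟨r, hr1, hr2⟩ := ENNReal.lt_iff_exists_nnreal_btwn.1 hcon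
    have hr0 : (0:ℝ) < r := by
      have : (0 : ENNReal) < r := lt_of_le_of_lt zero_le hr1
      exact_mod_cast this
    have hrS : (r:ℝ) < ⨅ k, S k := by
      by_contra h
      rw [not_lt] at h
      have := ENNReal.ofReal_le_ofReal h
      rw [ENNReal.ofReal_coe_nnreal] at this
      exact absurd hr2 (not_lt.2 this)
    have hSd : (⨅ k, S k) ≤ d := by
      let k : Fin d := ⟨d - 1, by omega⟩
      refine (hle k).trans ?_
      simp only [hS]
      rw [div_le_iff₀ (hden k)]
      have : ∑ i : Fin d, max (t k - t i) 0 = d * t k - τ := by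
        rw [← hsumt]
        have h1 : ∀ i, max (t k - t i) 0 = t k - t i := by
          intro i
          rw [← hmax, if_pos]
          rw [Fin.le_def]
          have := i.2
          simp only [k]
          omega
        simp only [h1, Finset.sum_sub_distrib, Finset.sum_const, Finset.card_univ, Fintype.card_fin,
          nsmul_eq_mul]
      rw [this]
      linarith
    obtain ⟨K, hK, hKx⟩ := WA.lower t ht0 (⨅ k, S k) hSd (by rw [hsumt]; exact hτ) (fun k => by
      have := hle k
      rw [← le_div_iff₀ (hden k)]
      exact this) r hr0 hrS
    have h1 := le_dimH_of_hausdorffMeasure_ne_zero (s := K) (d := r) hK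
    have h2 : dimH K ≤ dimH (WA.WW t) := dimH_mono fun x hx => hKx x hx
    exact absurd hr1 (not_lt.2 (h1.trans h2))
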